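/- arXiv:2204.02882 — 3 statements merged into one kernel-verified Lean document; each statement's English description precedes it below -/
import Mathlib

section
/- Let X be a hereditarily unicoherent continuum in which every indecomposable subcontinuum is nowhere dense. Then the quotient space of X by the partition into meager composants is a dendrite (a locally connected continuum containing no simple closed curve). -/
open Set Topology

/-- The meager composant of `x`: the union of all nowhere dense subcontinua containing `x`. -/
def MeagerComposant (X : Type) [TopologicalSpace X] (x : X) : Set X :=
  ⋃₀ {L : Set X | IsCompact L ∧ IsConnected L ∧ IsNowhereDense L ∧ x ∈ L}

/-- A continuum is hereditarily unicoherent if the intersection of any two subcontinua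
is connected (possibly empty, hence preconnected). -/
def HereditarilyUnicoherent (X : Type) [TopologicalSpace X] : Prop :=
  ∀ A B : Set X, IsCompact A → IsConnected A → IsCompact B → IsConnected B →
    IsPreconnected (A ∩ B)

/-- A subcontinuum `A` of `X` is ample if every open neighborhood of `A` contains a
subcontinuum having `A` in its interior. -/
def Ample {X : Type} [TopologicalSpace X] (A : Set X) : Prop :=
  ∀ U : Set X, IsOpen U → A ⊆ U →
    ∃ K : Set X, IsCompact K ∧ IsPreconnected K ∧ A ⊆ interior K ∧ K ⊆ U

/-- A set `C` is indecomposable if it is not the union of two proper subcontinua. -/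
def IndecomposableSet {X : Type} [TopologicalSpace X] (C : Set X) : Prop :=
  ¬ ∃ H K : Set X, IsCompact H ∧ IsConnected H ∧ IsCompact K ∧ IsConnected K ∧
    H ⊆ C ∧ K ⊆ C ∧ H ≠ C ∧ K ≠ C ∧ H ∪ K = C

/-- A dendrite: a (metrizable) locally connected continuum containing no simple closed curve. -/
def IsDendriteSpace (T : Type) [TopologicalSpace T] : Prop :=
  Nonempty T ∧ CompactSpace T ∧ ConnectedSpace T ∧ TopologicalSpace.MetrizableSpace T ∧
  LocallyConnectedSpace T ∧ ∀ S : Set T, ¬ Nonempty (S ≃ₜ Circle)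

/-- A finite tree (acyclic finite graph): a dendrite with finitely many endpoints
(equivalently, finitely many non-cut points). -/
def IsFiniteTreeSpace (T : Type) [MetricSpace T] : Prop :=
  IsDendriteSpace T ∧ {t : T | IsPreconnected ({t}ᶜ : Set T)}.Finite

/-- `X` is tree-like: for every `ε > 0` there is an `ε`-map of `X` onto a finite tree. -/
def TreeLike (X : Type) [MetricSpace X] : Prop :=
  ∀ ε : ℝ, 0 < ε → ∃ (T : Type), ∃ (_ : MetricSpace T), IsFiniteTreeSpace T ∧
    ∃ f : X → T, Continuous f ∧ Function.Surjective f ∧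
      ∀ t : T, Metric.diam (f ⁻¹' {t}) < ε

/-! ### Ultralimits of sets -/

set_option linter.unusedSectionVars false

section Aux

variable {X : Type} [TopologicalSpace X]

/-- Ultralimit of a family of sets. -/
def ulim {ι : Type} (F : Ultrafilter ι) (C : ι → Set X) : Set X :=
  {p | ∀ W ∈ 𝓝 p, ∀ᶠ i in F, (C i ∩ W).Nonempty}

lemma isClosed_ulim {ι : Type} (F : Ultrafilter ι) (C : ι → Set X) : IsClosed (ulim F C) := by
  rw [← isOpen_compl_iff, isOpen_iff_mem_nhds]
  intro p hp
  simp only [ulim, mem_compl_iff, mem_ofPred_eq, not_forall] at hp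
  obtain ⟨W, hW, h⟩ := hp
  obtain ⟨O, hOW, hO, hpO⟩ := mem_nhds_iff.1 hW
  filter_upwards [hO.mem_nhds hpO] with q hq hq'
  exact h ((hq' O (hO.mem_nhds hq)).mono fun i hi => hi.mono (inter_subset_inter_right _ hOW))

lemma ulim_meets [CompactSpace X] {ι : Type} (F : Ultrafilter ι) (C : ι → Set X) {Q : Set X}
    (hQ : IsClosed Q) (h : ∀ᶠ i in F, (C i ∩ Q).Nonempty) : (ulim F C ∩ Q).Nonempty := by
  by_contra hne
  have key : ∀ᶠ i in F, ¬ (C i ∩ Q).Nonempty := by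
    refine hQ.isCompact.induction_on (p := fun s => ∀ᶠ i in F, ¬ (C i ∩ s).Nonempty) ?_ ?_ ?_ ?_
    · simp
    · intro s t hst ht
      exact ht.mono fun i hi h => hi (h.mono (inter_subset_inter_right _ hst))
    · intro s t hs ht
      filter_upwards [hs, ht] with i h1 h2 h3
      rw [inter_union_distrib_left, union_nonempty] at h3
      tauto
    · intro q hq
      have : q ∉ ulim F C := fun h => hne ⟨q, h, hq⟩
      simp only [ulim, mem_ofPred_eq, not_forall] at this
      obtain ⟨W, hW, h⟩ := this
      exact ⟨W, mem_nhdsWithin_of_mem_nhds hW, Ultrafilter.eventually_not.2 h⟩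
  obtain ⟨i, h1, h2⟩ := (h.and key).exists
  exact h2 h1

lemma ulim_subset {ι : Type} (F : Ultrafilter ι) (C : ι → Set X) {Q : Set X}
    (hQ : IsClosed Q) (h : ∀ᶠ i in F, C i ⊆ Q) : ulim F C ⊆ Q := by
  intro p hp
  by_contra hpQ
  obtain ⟨i, h1, x, hx, hx'⟩ := (h.and (hp Qᶜ (hQ.isOpen_compl.mem_nhds hpQ))).exists
  exact hx' (h1 hx)

lemma mem_ulim {ι : Type} (F : Ultrafilter ι) (C : ι → Set X) {p : X} (f : ι → X)
    (hf : Filter.Tendsto f F (𝓝 p)) (h : ∀ᶠ i in F, f i ∈ C i) : p ∈ ulim F C := by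
  intro W hW
  filter_upwards [hf hW, h] with i h1 h2 using ⟨f i, h2, h1⟩

lemma isPreconnected_ulim [CompactSpace X] [T2Space X] {ι : Type} (F : Ultrafilter ι)
    (C : ι → Set X) (h : ∀ᶠ i in F, IsPreconnected (C i)) : IsPreconnected (ulim F C) := by
  rw [isPreconnected_iff_subset_of_fully_disjoint_closed (isClosed_ulim F C)]
  intro u v hu hv huv hd
  obtain ⟨U, V, hU, hV, huU, hvV, hUV⟩ := normal_separation hu hv hd
  have h1 : ∀ᶠ i in F, ¬ (C i ∩ (U ∪ V)ᶜ).Nonempty := by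
    rw [Ultrafilter.eventually_not]
    intro h2
    obtain ⟨p, hp, hp'⟩ := ulim_meets F C (hU.union hV).isClosed_compl h2
    rcases huv hp with h | h
    · exact hp' (Or.inl (huU h))
    · exact hp' (Or.inr (hvV h))
  have h2 : ∀ᶠ i in F, C i ⊆ Vᶜ ∨ C i ⊆ Uᶜ := by
    filter_upwards [h, h1] with i hi hi'
    have hsub : C i ⊆ U ∪ V := by
      intro p hp
      by_contra hh
      exact hi' ⟨p, hp, hh⟩
    rcases hi.subset_or_subset hU hV hUV hsub with h | h
    · exact Or.inl (h.trans hUV.subset_compl_right)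
    · exact Or.inr (h.trans hUV.subset_compl_left)
  rw [Ultrafilter.eventually_or] at h2
  rcases h2 with h2 | h2
  · left
    intro p hp
    exact (huv hp).resolve_right fun hpv => ulim_subset F C hV.isClosed_compl h2 hp (hvV hpv)
  · right
    intro p hp
    exact (huv hp).resolve_left fun hpv => ulim_subset F C hU.isClosed_compl h2 hp (huU hpv)

/-! ### Continua -/

/-- A subcontinuum. -/
def SubCtm (A : Set X) : Prop := IsCompact A ∧ IsConnected A

lemma SubCtm.union {A B : Set X} (hA : SubCtm A) (hB : SubCtm B) (h : (A ∩ B).Nonempty) :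
    SubCtm (A ∪ B) := ⟨hA.1.union hB.1, hA.2.union h hB.2⟩

lemma SubCtm.isClosed [T2Space X] {A : Set X} (hA : SubCtm A) : IsClosed A := hA.1.isClosed

lemma SubCtm.inter [T2Space X] (hX : HereditarilyUnicoherent X) {A B : Set X} (hA : SubCtm A)
    (hB : SubCtm B) (h : (A ∩ B).Nonempty) : SubCtm (A ∩ B) :=
  ⟨hA.1.inter hB.1, h, hX A B hA.1 hA.2 hB.1 hB.2⟩

lemma helly3 [T2Space X] (hX : HereditarilyUnicoherent X) {A B C : Set X} (hA : SubCtm A)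
    (hB : SubCtm B) (hC : SubCtm C) (hAB : (A ∩ B).Nonempty) (hAC : (A ∩ C).Nonempty)
    (hBC : (B ∩ C).Nonempty) : (A ∩ B ∩ (A ∩ C)).Nonempty := by
  have h := (SubCtm.inter hX hA (hB.union hC hBC) (hAB.mono
    (inter_subset_inter_right _ subset_union_left))).2.isPreconnected
  rw [isPreconnected_closed_iff] at h
  obtain ⟨p, ⟨hp, _⟩, hp1, hp2⟩ := h B C hB.isClosed hC.isClosed inter_subset_right
    (hAB.mono fun p hp => ⟨⟨hp.1, Or.inl hp.2⟩, hp.2⟩)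
    (hAC.mono fun p hp => ⟨⟨hp.1, Or.inr hp.2⟩, hp.2⟩)
  exact ⟨p, ⟨hp, hp1⟩, hp, hp2⟩

lemma helly_finset [T2Space X] (hX : HereditarilyUnicoherent X) {ι : Type} (s : Finset ι)
    (hs : s.Nonempty) : ∀ f : ι → Set X, (∀ i, SubCtm (f i)) → (∀ i j, (f i ∩ f j).Nonempty) →
    SubCtm (⋂ i ∈ s, f i) := by
  classical
  induction hs using Finset.Nonempty.cons_induction with
  | singleton a => intro f hf _; simpa using hf a
  | cons a s ha hs ih =>
    intro f hf hff
    have := ih (fun i => f a ∩ f i) (fun i => (hf a).inter hX (hf i) (hff a i))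
      (fun i j => helly3 hX (hf a) (hf i) (hf j) (hff a i) (hff a j) (hff i j))
    convert this using 1
    ext p
    obtain ⟨b, hb⟩ := hs
    simp only [Finset.mem_cons, mem_iInter, mem_inter_iff]
    constructor
    · intro h i hi
      exact ⟨h a (Or.inl rfl), h i (Or.inr hi)⟩
    · rintro h i (rfl | hi)
      · exact (h b hb).1
      · exact (h i hi).2

lemma helly [T2Space X] [CompactSpace X] (hX : HereditarilyUnicoherent X) {ι : Type} [Nonempty ι]
    (f : ι → Set X) (hf : ∀ i, SubCtm (f i)) (hff : ∀ i j, (f i ∩ f j).Nonempty) :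
    SubCtm (⋂ i, f i) := by
  classical
  let F : Ultrafilter (Finset ι) := Ultrafilter.of Filter.atTop
  have hF : (F : Filter (Finset ι)) ≤ Filter.atTop := Ultrafilter.of_le _
  let C : Finset ι → Set X := fun s => ⋂ i ∈ s, f i
  have hne : ∀ᶠ s : Finset ι in F, s.Nonempty := by
    obtain ⟨i⟩ := ‹Nonempty ι›
    refine hF ?_
    filter_upwards [Filter.eventually_ge_atTop ({i} : Finset ι)] with s hs
    exact ⟨i, hs (by simp)⟩
  have hC : ∀ᶠ s in F, SubCtm (C s) := hne.mono fun s hs => helly_finset hX s hs f hf hff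
  have heq : ulim F C = ⋂ i, f i := by
    apply Subset.antisymm
    · refine subset_iInter fun i => ulim_subset F C (hf i).isClosed (hF ?_)
      filter_upwards [Filter.eventually_ge_atTop ({i} : Finset ι)] with s hs
      exact biInter_subset_of_mem (hs (by simp))
    · intro p hp
      refine mem_ulim F C (fun _ => p) tendsto_const_nhds (Filter.Eventually.of_forall fun s => ?_)
      simp only [mem_iInter, C] at hp ⊢
      exact fun i _ => hp i
  rw [← heq]
  refine ⟨(isClosed_ulim F C).isCompact, ?_, isPreconnected_ulim F C (hC.mono fun s hs => hs.2.2)⟩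
  have := ulim_meets F C isClosed_univ (hC.mono fun s hs => by simpa using hs.2.1)
  simpa using this

/-- Boundary bumping. -/
lemma bump [T2Space X] {J Q : Set X} {b : X} (hJ : SubCtm J) (hQ : IsClosed Q) (hb : b ∈ J)
    (hbQ : b ∉ Q) (hne : (J ∩ Q).Nonempty) :
    ∃ C, SubCtm C ∧ b ∈ C ∧ C ⊆ closure (J \ Q) ∧ (C ∩ Q).Nonempty := by
  set E := closure (J \ Q) with hE
  have hEJ : E ⊆ J := closure_minimal sdiff_subset hJ.isClosed
  have hEc : IsCompact E := hJ.1.of_isClosed_subset isClosed_closure hEJ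
  have hbE : b ∈ E := subset_closure ⟨hb, hbQ⟩
  have : CompactSpace E := isCompact_iff_compactSpace.1 hEc
  refine ⟨Subtype.val '' connectedComponent (⟨b, hbE⟩ : E), ⟨?_, ?_⟩, ?_, ?_, ?_⟩
  · exact isClosed_connectedComponent.isCompact.image continuous_subtype_val
  · exact isConnected_connectedComponent.image _ continuous_subtype_val.continuousOn
  · exact ⟨_, mem_connectedComponent, rfl⟩
  · rintro _ ⟨p, _, rfl⟩; exact p.2
  · by_contra hcon
    rw [connectedComponent_eq_iInter_isClopen] at hcon
    have hQ' : IsClosed ((↑) ⁻¹' Q : Set E) := hQ.preimage continuous_subtype_val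
    have : Nonempty { s : Set E // IsClopen s ∧ (⟨b, hbE⟩ : E) ∈ s } :=
      ⟨⟨univ, isClopen_univ, mem_univ _⟩⟩
    have := hQ'.isCompact.elim_directed_family_closed
      (fun s : { s : Set E // IsClopen s ∧ (⟨b, hbE⟩ : E) ∈ s } => s.1) (fun s => s.2.1.1) ?_ ?_
    · obtain ⟨⟨Z, hZ, hbZ⟩, hZQ⟩ := this
      dsimp only at hZQ
      have h1 : IsClosed (Subtype.val '' Z) :=
        (hZ.1.isCompact.image continuous_subtype_val).isClosed
      have h2 : IsClosed (Subtype.val '' Zᶜ ∪ Q) :=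
        (hZ.compl.1.isCompact.image continuous_subtype_val).isClosed.union hQ
      obtain ⟨p, hp, ⟨z, hz, rfl⟩, hp2⟩ := isPreconnected_closed_iff.1 hJ.2.2 _ _ h1 h2 (by
        intro p hp
        by_cases hpQ : p ∈ Q
        · exact Or.inr (Or.inr hpQ)
        · by_cases hpZ : (⟨p, subset_closure ⟨hp, hpQ⟩⟩ : E) ∈ Z
          · exact Or.inl ⟨_, hpZ, rfl⟩
          · exact Or.inr (Or.inl ⟨_, hpZ, rfl⟩)) ⟨b, hb, _, hbZ, rfl⟩
          (hne.mono fun p hp => ⟨hp.1, Or.inr hp.2⟩)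
      rcases hp2 with ⟨w, hw, hwz⟩ | hzQ
      · rw [Subtype.val_injective hwz] at hw
        exact hw hz
      · have : z ∈ ((↑) ⁻¹' Q ∩ Z : Set E) := ⟨hzQ, hz⟩
        rw [hZQ] at this
        exact this
    · rw [eq_empty_iff_forall_notMem]
      rintro z ⟨hz1, hz2⟩
      exact hcon ⟨z, ⟨z, hz2, rfl⟩, hz1⟩
    · rintro ⟨s, hs, hbs⟩ ⟨t, ht, hbt⟩
      exact ⟨⟨s ∩ t, hs.inter ht, hbs, hbt⟩, inter_subset_left, inter_subset_right⟩

/-! ### Irreducible subcontinua -/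

/-- The smallest subcontinuum containing `x` and `y`. -/
def irr (x y : X) : Set X := ⋂ A : {A : Set X // SubCtm A ∧ x ∈ A ∧ y ∈ A}, A.1

lemma left_mem_irr (x y : X) : x ∈ irr x y := mem_iInter.2 fun A => A.2.2.1
lemma right_mem_irr (x y : X) : y ∈ irr x y := mem_iInter.2 fun A => A.2.2.2
lemma irr_subset {x y : X} {A : Set X} (hA : SubCtm A) (hx : x ∈ A) (hy : y ∈ A) : irr x y ⊆ A :=
  iInter_subset (fun A : {A : Set X // SubCtm A ∧ x ∈ A ∧ y ∈ A} => A.1) ⟨A, hA, hx, hy⟩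

lemma irr_comm (x y : X) : irr x y = irr y x := by
  ext p
  simp only [irr, mem_iInter]
  exact ⟨fun h A => h ⟨A.1, A.2.1, A.2.2.2, A.2.2.1⟩, fun h A => h ⟨A.1, A.2.1, A.2.2.2, A.2.2.1⟩⟩

lemma cont_irr [T2Space X] [CompactSpace X] [ConnectedSpace X] (hX : HereditarilyUnicoherent X)
    (x y : X) : SubCtm (irr x y) := by
  have : Nonempty {A : Set X // SubCtm A ∧ x ∈ A ∧ y ∈ A} :=
    ⟨⟨univ, ⟨isCompact_univ, isConnected_univ⟩, mem_univ _, mem_univ _⟩⟩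
  exact helly hX _ (fun A => A.2.1) (fun A B => ⟨x, A.2.2.1, B.2.2.1⟩)

/-! ### The relation -/

/-- Equivalence of points: the irreducible subcontinuum between them is nowhere dense. -/
def rel (x y : X) : Prop := interior (irr x y) = ∅

/-- Every subcontinuum with interior is decomposable. -/
def Decomp (X : Type) [TopologicalSpace X] : Prop :=
  ∀ J : Set X, SubCtm J → (interior J).Nonempty → ∃ H K : Set X, SubCtm H ∧ SubCtm K ∧
    H ≠ J ∧ K ≠ J ∧ H ∪ K = J

lemma rel_symm {x y : X} (h : rel x y) : rel y x := by
  unfold rel at *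
  rwa [irr_comm]

lemma rel_of_subset {x y : X} {A : Set X} (hA : SubCtm A) (hx : x ∈ A) (hy : y ∈ A)
    (h : interior A = ∅) : rel x y :=
  subset_eq_empty (interior_mono (irr_subset hA hx hy)) h

lemma rel_refl (hD : Decomp X) (x : X) : rel x x := by
  have hx : SubCtm ({x} : Set X) := ⟨isCompact_singleton, isConnected_singleton⟩
  refine rel_of_subset hx rfl rfl ?_
  by_contra h
  obtain ⟨H, K, hH, -, hHx, -, hHK⟩ := hD _ hx (nonempty_iff_ne_empty.2 h)
  exact hHx ((subset_singleton_iff_eq.1 (hHK ▸ subset_union_left)).resolve_left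
    hH.2.1.ne_empty)

variable [T2Space X] [CompactSpace X] [ConnectedSpace X]

lemma irr_subset_union (hX : HereditarilyUnicoherent X) (x y z : X) :
    irr x z ⊆ irr x y ∪ irr y z :=
  irr_subset ((cont_irr hX x y).union (cont_irr hX y z)
    ⟨y, right_mem_irr _ _, left_mem_irr _ _⟩) (Or.inl (left_mem_irr _ _))
    (Or.inr (right_mem_irr _ _))

lemma rel_trans (hX : HereditarilyUnicoherent X) {x y z : X} (h1 : rel x y) (h2 : rel y z) :
    rel x z := by
  refine subset_eq_empty (interior_mono (irr_subset_union hX x y z)) ?_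
  rw [interior_union_isClosed_of_interior_empty (cont_irr hX x y).isClosed h2]
  exact h1

lemma interior_irr_subset (hX : HereditarilyUnicoherent X) {x y a b : X} (h1 : rel x a)
    (h2 : rel y b) : interior (irr x y) ⊆ irr a b := by
  have h : irr x y ⊆ (irr a b ∪ irr x a) ∪ irr y b := by
    have h3 := irr_subset_union hX x a y
    have h4 := irr_subset_union hX a b y
    rw [irr_comm b y] at h4
    intro p hp
    rcases h3 hp with h | h
    · exact Or.inl (Or.inr h)
    · rcases h4 h with h | h
      · exact Or.inl (Or.inl h)
      · exact Or.inr h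
  refine (interior_mono h).trans ?_
  rw [interior_union_isClosed_of_interior_empty
    ((cont_irr hX a b).isClosed.union (cont_irr hX x a).isClosed) h2,
    interior_union_isClosed_of_interior_empty (cont_irr hX a b).isClosed h1]
  exact interior_subset

lemma open_diff_nonempty {O N : Set X} (hO : IsOpen O) (hne : O.Nonempty)
    (h : interior N = ∅) : (O \ N).Nonempty := by
  by_contra hcon
  rw [not_nonempty_iff_eq_empty, sdiff_eq_empty] at hcon
  have := interior_maximal hcon hO
  rw [h] at this
  exact hne.ne_empty (subset_empty_iff.1 this)

/-- Points of `irr x y` equivalent to `x`. -/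
def Rset (x y : X) : Set X := {a | a ∈ irr x y ∧ rel x a}

/-- The core of `irr x y`. -/
def core (x y : X) : Set X := ⋂ p : Rset x y × Rset y x, irr p.1.1 p.2.1

lemma core_comm (x y : X) : core x y = core y x := by
  ext p
  simp only [core, mem_iInter]
  exact ⟨fun h q => irr_comm q.2.1 q.1.1 ▸ h (q.2, q.1),
    fun h q => irr_comm q.2.1 q.1.1 ▸ h (q.2, q.1)⟩

lemma left_mem_Rset (hD : Decomp X) (x y : X) : x ∈ Rset x y := ⟨left_mem_irr _ _, rel_refl hD x⟩

lemma core_subset_irr {x y a b : X} (ha : a ∈ Rset x y) (hb : b ∈ Rset y x) :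
    core x y ⊆ irr a b :=
  iInter_subset (fun p : Rset x y × Rset y x => irr p.1.1 p.2.1) (⟨a, ha⟩, ⟨b, hb⟩)

lemma interior_subset_core (hX : HereditarilyUnicoherent X) (x y : X) :
    interior (irr x y) ⊆ core x y :=
  subset_iInter fun p => interior_irr_subset hX p.1.2.2 p.2.2.2

lemma cont_core (hX : HereditarilyUnicoherent X) (hD : Decomp X) {x y : X}
    (hO : (interior (irr x y)).Nonempty) : SubCtm (core x y) := by
  have : Nonempty (Rset x y × Rset y x) :=
    ⟨(⟨x, left_mem_Rset hD x y⟩, ⟨y, left_mem_Rset hD y x⟩)⟩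
  obtain ⟨o, ho⟩ := hO
  exact helly hX _ (fun p => cont_irr hX _ _)
    (fun p q => ⟨o, interior_irr_subset hX p.1.2.2 p.2.2.2 ho,
      interior_irr_subset hX q.1.2.2 q.2.2.2 ho⟩)

lemma cont_closure {A : Set X} (h : IsConnected A) : SubCtm (closure A) :=
  ⟨isClosed_closure.isCompact, h.closure⟩

lemma isConnected_Rset (hX : HereditarilyUnicoherent X) (hD : Decomp X) (x y : X) :
    IsConnected (Rset x y) := by
  refine ⟨⟨x, left_mem_Rset hD x y⟩, ?_⟩
  refine isPreconnected_of_forall x fun a ha => ⟨irr x a, ?_, left_mem_irr _ _, right_mem_irr _ _,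
    (cont_irr hX x a).2.2⟩
  intro c hc
  exact ⟨irr_subset (cont_irr hX x y) (left_mem_irr _ _) ha.1 hc,
    rel_of_subset (cont_irr hX x a) (left_mem_irr _ _) hc ha.2⟩

lemma core_meets (hX : HereditarilyUnicoherent X) (hD : Decomp X) {x y : X}
    (hO : (interior (irr x y)).Nonempty) : (core x y ∩ Rset x y).Nonempty := by
  by_contra hcon
  have hsub : closure (Rset x y) ⊆ irr x y :=
    closure_minimal (fun a ha => ha.1) (cont_irr hX x y).isClosed
  have hdis : Disjoint (interior (irr x y)) (closure (Rset x y)) := by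
    refine Disjoint.closure_right ?_ isOpen_interior
    rw [Set.disjoint_left]
    exact fun p hp hp' => hcon ⟨p, interior_subset_core hX x y hp, hp'⟩
  have hempty : interior (closure (Rset x y)) = ∅ := by
    rw [eq_empty_iff_forall_notMem]
    intro p hp
    exact Set.disjoint_left.1 hdis (interior_mono hsub hp) (interior_subset hp)
  have hc := cont_closure (isConnected_Rset hX hD x y)
  have hcl : closure (Rset x y) ⊆ Rset x y := fun c hcc =>
    ⟨hsub hcc, rel_of_subset hc (subset_closure (left_mem_Rset hD x y)) hcc hempty⟩
  have hR : SubCtm (Rset x y) := by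
    rwa [Subset.antisymm hcl subset_closure] at hc
  obtain ⟨o, ho⟩ := hO
  have := helly hX (fun i : Option (Rset x y × Rset y x) =>
    i.elim (Rset x y) (fun p => irr p.1.1 p.2.1)) (by
      rintro (_ | p)
      · exact hR
      · exact cont_irr hX _ _) (by
      rintro (_ | p) (_ | q)
      · exact ⟨x, left_mem_Rset hD x y, left_mem_Rset hD x y⟩
      · exact ⟨q.1.1, q.1.2, left_mem_irr _ _⟩
      · exact ⟨p.1.1, left_mem_irr _ _, p.1.2⟩
      · exact ⟨o, interior_irr_subset hX p.1.2.2 p.2.2.2 ho,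
          interior_irr_subset hX q.1.2.2 q.2.2.2 ho⟩)
  obtain ⟨p, hp⟩ := this.2.1
  rw [mem_iInter] at hp
  exact hcon ⟨p, mem_iInter.2 fun q => hp (some q), hp none⟩

lemma half (hX : HereditarilyUnicoherent X) (hD : Decomp X) {x y : X}
    (hO : (interior (irr x y)).Nonempty) {Q : Set X} (hQ : IsClosed Q)
    (hQJ : (core x y ∩ Q).Nonempty) (hQR : ∀ a ∈ Q, a ∉ Rset x y) :
    (interior (irr x y) \ Q).Nonempty := by
  by_contra hcon
  rw [not_nonempty_iff_eq_empty, sdiff_eq_empty] at hcon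
  have hJ := cont_core hX hD hO
  obtain ⟨b, hbJ, hbR⟩ := core_meets hX hD hO
  obtain ⟨C, hC, hbC, hCs, q, hqC, hqQ⟩ := bump hJ hQ hbJ (fun h => hQR b h hbR) hQJ
  have hJI : core x y ⊆ irr x y := core_subset_irr (left_mem_Rset hD x y) (left_mem_Rset hD y x)
  have hCI : C ⊆ irr x y :=
    hCs.trans ((closure_minimal sdiff_subset hJ.isClosed).trans hJI)
  have hdis : Disjoint (interior (irr x y)) C := by
    refine Disjoint.mono_right hCs (Disjoint.closure_right ?_ isOpen_interior)
    rw [Set.disjoint_left]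
    exact fun p hp hp' => hp'.2 (hcon hp)
  have hempty : interior C = ∅ := by
    rw [eq_empty_iff_forall_notMem]
    intro p hp
    exact Set.disjoint_left.1 hdis (interior_mono hCI hp) (interior_subset hp)
  exact hQR q hqQ ⟨hCI hqC, rel_trans hX hbR.2 (rel_of_subset hC hbC hqC hempty)⟩

lemma claim1 (hX : HereditarilyUnicoherent X) (hD : Decomp X) {x y : X}
    (hO : (interior (irr x y)).Nonempty) : ∃ H K : Set X, SubCtm H ∧ SubCtm K ∧ x ∈ H ∧ y ∈ K ∧
      H ∪ K = irr x y ∧ (interior (irr x y) \ H).Nonempty ∧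
      (interior (irr x y) \ K).Nonempty := by
  have hO' : (interior (irr y x)).Nonempty := by rwa [irr_comm]
  have hJ := cont_core hX hD hO
  have hJI : core x y ⊆ irr x y := core_subset_irr (left_mem_Rset hD x y) (left_mem_Rset hD y x)
  obtain ⟨a, haJ, haR⟩ := core_meets hX hD hO
  obtain ⟨b, hbJ, hbS⟩ := core_meets hX hD hO'
  rw [core_comm] at hbJ
  have no_both : ∀ J', SubCtm J' → J' ⊆ core x y → J' ≠ core x y → ∀ c ∈ J', c ∈ Rset x y →
      ∀ d ∈ J', d ∈ Rset y x → False := by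
    intro J' h1 h2 h3 c hc hcR d hd hdS
    exact h3 (Subset.antisymm h2 ((core_subset_irr hcR hdS).trans (irr_subset h1 hc hd)))
  obtain ⟨J1, J2, hJ1, hJ2, hne1, hne2, hJJ, ha2⟩ : ∃ J1 J2 : Set X, SubCtm J1 ∧ SubCtm J2 ∧
      J1 ≠ core x y ∧ J2 ≠ core x y ∧ J1 ∪ J2 = core x y ∧ a ∈ J2 := by
    obtain ⟨J1, J2, hJ1, hJ2, hne1, hne2, hJJ⟩ := hD _ hJ
      (hO.mono (interior_maximal (interior_subset_core hX x y) isOpen_interior))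
    rcases (hJJ.symm ▸ haJ : a ∈ J1 ∪ J2) with h | h
    · exact ⟨J2, J1, hJ2, hJ1, hne2, hne1, by rw [union_comm, hJJ], h⟩
    · exact ⟨J1, J2, hJ1, hJ2, hne1, hne2, hJJ, h⟩
  have hJ1s : J1 ⊆ core x y := hJJ ▸ subset_union_left
  have hJ2s : J2 ⊆ core x y := hJJ ▸ subset_union_right
  have hb1 : b ∈ J1 := by
    rcases (hJJ.symm ▸ hbJ : b ∈ J1 ∪ J2) with h | h
    · exact h
    · exact (no_both J2 hJ2 hJ2s hne2 a ha2 haR b h hbS).elim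
  have h2 : (interior (irr x y) \ J2).Nonempty := by
    have := half hX hD hO' hJ2.isClosed ⟨a, core_comm x y ▸ haJ, ha2⟩
      (fun d hd hdS => no_both J2 hJ2 hJ2s hne2 a ha2 haR d hd hdS)
    rwa [irr_comm] at this
  have h1 : (interior (irr x y) \ J1).Nonempty :=
    half hX hD hO hJ1.isClosed ⟨b, hbJ, hb1⟩
      (fun d hd hdS => no_both J1 hJ1 hJ1s hne1 d hd hdS b hb1 hbS)
  have hJ12 : (J1 ∩ J2).Nonempty := by
    obtain ⟨p, _, hp⟩ := isPreconnected_closed_iff.1 hJ.2.2 J1 J2 hJ1.isClosed hJ2.isClosed hJJ.ge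
      ⟨b, hbJ, hb1⟩ ⟨a, haJ, ha2⟩
    exact ⟨p, hp⟩
  have hH : SubCtm (irr x a ∪ J2) := (cont_irr hX x a).union hJ2 ⟨a, right_mem_irr _ _, ha2⟩
  have hK : SubCtm (irr y b ∪ J1) := (cont_irr hX y b).union hJ1 ⟨b, right_mem_irr _ _, hb1⟩
  refine ⟨_, _, hH, hK, Or.inl (left_mem_irr _ _), Or.inl (left_mem_irr _ _), ?_, ?_, ?_⟩
  · apply Subset.antisymm
    · have e1 : irr x a ⊆ irr x y := irr_subset (cont_irr hX x y) (left_mem_irr _ _) haR.1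
      have e2 : irr y b ⊆ irr x y :=
        irr_subset (cont_irr hX x y) (right_mem_irr _ _) (hJI hbJ)
      exact union_subset (union_subset e1 (hJ2s.trans hJI)) (union_subset e2 (hJ1s.trans hJI))
    · exact irr_subset (hH.union hK (hJ12.mono fun p hp => ⟨Or.inr hp.2, Or.inr hp.1⟩))
        (Or.inl (Or.inl (left_mem_irr _ _))) (Or.inr (Or.inl (left_mem_irr _ _)))
  · rw [union_comm, ← sdiff_sdiff]
    exact open_diff_nonempty (isOpen_interior.sdiff hJ2.isClosed) h2 haR.2
  · rw [union_comm, ← sdiff_sdiff]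
    exact open_diff_nonempty (isOpen_interior.sdiff hJ1.isClosed) h1 hbS.2

lemma claim1' (hX : HereditarilyUnicoherent X) (hD : Decomp X) {x y : X}
    (hO : (interior (irr x y)).Nonempty) : ∃ H K : Set X, SubCtm H ∧ SubCtm K ∧ x ∈ H ∧ y ∈ K ∧
      H ∪ K = irr x y ∧ (interior (irr x y) \ H).Nonempty ∧
      (interior (irr x y) \ K).Nonempty ∧ interior (H ∩ K) = ∅ := by
  obtain ⟨H, K, hH, hK, hx, hy, hHK, h1, h2⟩ := claim1 hX hD hO
  have hyH : y ∉ H := by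
    intro h
    obtain ⟨p, hp, hp'⟩ := h1
    exact hp' (irr_subset hH hx h (interior_subset hp))
  obtain ⟨C, hC, hyC, hCs, hCH⟩ := bump (cont_irr hX x y) hH.isClosed (right_mem_irr x y) hyH
    ⟨x, left_mem_irr x y, hx⟩
  have hCK : C ⊆ K := hCs.trans (closure_minimal (by
    intro p hp
    exact (hHK.ge hp.1).resolve_left hp.2) hK.isClosed)
  refine ⟨H, C, hH, hC, hx, hyC, ?_, h1, h2.mono fun p hp => ⟨hp.1, fun h => hp.2 (hCK h)⟩, ?_⟩
  · apply Subset.antisymm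
    · rw [← hHK]
      exact union_subset_union_right _ hCK
    · exact irr_subset (hH.union hC (by rwa [inter_comm])) (Or.inl hx) (Or.inr hyC)
  · rw [eq_empty_iff_forall_notMem]
    intro p hp
    obtain ⟨q, hq, hq'⟩ := mem_closure_iff.1 (hCs (interior_subset hp).2) _ isOpen_interior hp
    exact hq'.2 (interior_subset hq).1

lemma claim2 (hX : HereditarilyUnicoherent X) (hD : Decomp X) {x y : X}
    (hO : (interior (irr x y)).Nonempty) : ∃ H K G : Set X, SubCtm H ∧ SubCtm K ∧ x ∈ H ∧ y ∈ K ∧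
      (interior H).Nonempty ∧ (interior K).Nonempty ∧ H ⊆ irr x y ∧ K ⊆ irr x y ∧
      IsOpen G ∧ G.Nonempty ∧ G ⊆ irr x y \ (H ∪ K) := by
  obtain ⟨H, K, hH, hK, hx, hy, hHK, h1, h2, h3⟩ := claim1' hX hD hO
  obtain ⟨z, -, hzH, hzK⟩ := isPreconnected_closed_iff.1 (cont_irr hX x y).2.2 H K hH.isClosed
    hK.isClosed hHK.ge ⟨x, left_mem_irr _ _, hx⟩ ⟨y, right_mem_irr _ _, hy⟩
  have hHI : H ⊆ irr x y := hHK ▸ subset_union_left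
  have hKI : K ⊆ irr x y := hHK ▸ subset_union_right
  have hIH : irr x z ⊆ H := irr_subset hH hx hzH
  have hIK : irr y z ⊆ K := irr_subset hK hy hzK
  have hsub : irr x y ⊆ irr x z ∪ irr y z := by
    have := irr_subset_union hX x z y
    rwa [irr_comm z y] at this
  have o1 : (interior (irr x z)).Nonempty := by
    refine h2.mono (interior_maximal ?_ (isOpen_interior.sdiff hK.isClosed))
    intro p hp
    exact (hsub (interior_subset hp.1)).resolve_right fun h => hp.2 (hIK h)
  have o2 : (interior (irr y z)).Nonempty := by
    refine h1.mono (interior_maximal ?_ (isOpen_interior.sdiff hH.isClosed))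
    intro p hp
    exact (hsub (interior_subset hp.1)).resolve_left fun h => hp.2 (hIH h)
  obtain ⟨H1, H2, hH1, hH2, hxH1, -, hHH, a1, a2⟩ := claim1 hX hD o1
  obtain ⟨K1, K2, hK1, hK2, hyK1, -, hKK, b1, b2⟩ := claim1 hX hD o2
  have hH1s : H1 ⊆ irr x z := hHH ▸ subset_union_left
  have hK1s : K1 ⊆ irr y z := hKK ▸ subset_union_left
  refine ⟨H1, K1, (interior (irr x z) \ H1) \ K1, hH1, hK1, hxH1, hyK1, ?_, ?_,
    hH1s.trans (hIH.trans hHI), hK1s.trans (hIK.trans hKI),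
    (isOpen_interior.sdiff hH1.isClosed).sdiff hK1.isClosed, ?_, ?_⟩
  · refine a2.mono (interior_maximal ?_ (isOpen_interior.sdiff hH2.isClosed))
    intro p hp
    exact (hHH.ge (interior_subset hp.1)).resolve_right hp.2
  · refine b2.mono (interior_maximal ?_ (isOpen_interior.sdiff hK2.isClosed))
    intro p hp
    exact (hKK.ge (interior_subset hp.1)).resolve_right hp.2
  · refine (open_diff_nonempty (isOpen_interior.sdiff hH1.isClosed) a1 h3).mono ?_
    intro p hp
    exact ⟨hp.1, fun h => hp.2 ⟨hIH (interior_subset hp.1.1), hIK (hK1s h)⟩⟩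
  · intro p hp
    exact ⟨hHI (hIH (interior_subset hp.1.1)), fun h => h.elim hp.1.2 hp.2⟩

lemma isClosed_rel (hX : HereditarilyUnicoherent X) (hD : Decomp X) :
    IsClosed {p : X × X | rel p.1 p.2} := by
  refine isClosed_iff_ultrafilter.2 ?_
  rintro ⟨x, y⟩ F hF hmem
  by_contra hcon
  obtain ⟨H, K, G, hH, hK, hx, hy, hiH, hiK, hHI, hKI, hG, hGne, hGs⟩ :=
    claim2 hX hD (nonempty_iff_ne_empty.2 hcon)
  let C : X × X → Set X := fun p => irr p.1 p.2
  have hxL : x ∈ ulim F C := mem_ulim F C Prod.fst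
    ((continuous_fst.tendsto (x, y)).mono_left hF)
    (Filter.Eventually.of_forall fun p => left_mem_irr _ _)
  have hyL : y ∈ ulim F C := mem_ulim F C Prod.snd
    ((continuous_snd.tendsto (x, y)).mono_left hF)
    (Filter.Eventually.of_forall fun p => right_mem_irr _ _)
  have hL : SubCtm (ulim F C) := ⟨(isClosed_ulim F C).isCompact, ⟨x, hxL⟩,
    isPreconnected_ulim F C (Filter.Eventually.of_forall fun p => (cont_irr hX _ _).2.2)⟩
  have hIL := irr_subset hL hxL hyL
  obtain ⟨h, hh⟩ := hiH
  obtain ⟨k, hk⟩ := hiK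
  obtain ⟨p, hp, ⟨u, hu, hu'⟩, v, hv, hv'⟩ := (Filter.Eventually.and hmem
    ((hIL (hHI (interior_subset hh)) _ (isOpen_interior.mem_nhds hh)).and
    (hIL (hKI (interior_subset hk)) _ (isOpen_interior.mem_nhds hk)))).exists
  have hU : SubCtm ((H ∪ irr p.1 p.2) ∪ K) :=
    (hH.union (cont_irr hX _ _) ⟨u, interior_subset hu', hu⟩).union hK
      ⟨v, Or.inr hv, interior_subset hv'⟩
  have hs := irr_subset hU (Or.inl (Or.inl hx)) (Or.inr hy)
  have : G ⊆ interior (irr p.1 p.2) := by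
    refine interior_maximal ?_ hG
    intro g hg
    have h1 := hGs hg
    rcases hs h1.1 with (h | h) | h
    · exact (h1.2 (Or.inl h)).elim
    · exact h
    · exact (h1.2 (Or.inr h)).elim
  rw [show interior (irr p.1 p.2) = ∅ from hp] at this
  exact hGne.ne_empty (subset_empty_iff.1 this)

/-! ### The quotient -/

lemma isPreconnected_class (hX : HereditarilyUnicoherent X) (x : X) :
    IsPreconnected {a | rel x a} := by
  by_cases hx : rel x x
  · refine isPreconnected_of_forall x fun a ha => ⟨irr x a, ?_, left_mem_irr _ _,
      right_mem_irr _ _, (cont_irr hX x a).2.2⟩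
    exact fun c hc => rel_of_subset (cont_irr hX x a) (left_mem_irr _ _) hc ha
  · have : {a | rel x a} = ∅ := by
      rw [eq_empty_iff_forall_notMem]
      exact fun a ha => hx (rel_trans hX ha (rel_symm ha))
    rw [this]
    exact isPreconnected_empty

variable {Y : Type} [TopologicalSpace Y] {f : X → Y}

lemma closedMap (hX : HereditarilyUnicoherent X) (hD : Decomp X) (hf : IsQuotientMap f)
    (hr : ∀ a b, f a = f b ↔ rel a b) : IsClosedMap f := by
  intro F hF
  rw [← hf.isClosed_preimage]
  have : f ⁻¹' (f '' F) = Prod.snd '' ((F ×ˢ univ) ∩ {p : X × X | rel p.1 p.2}) := by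
    ext b
    simp only [mem_preimage, mem_image, mem_inter_iff, mem_prod, mem_univ, and_true, Prod.exists,
      exists_eq_right]
    exact ⟨fun ⟨a, ha, h⟩ => ⟨a, ha, (hr a b).1 h⟩, fun ⟨a, ha, h⟩ => ⟨a, ha, (hr a b).2 h⟩⟩
  rw [this]
  exact ((hF.prod isClosed_univ).inter (isClosed_rel hX hD)).isCompact.image continuous_snd
    |>.isClosed

lemma isOpen_kern (hcl : IsClosedMap f) {U : Set X} (hU : IsOpen U) : IsOpen (kernImage f U) :=
  isClosedMap_iff_kernImage.1 hcl hU

lemma t2_of_closedMap [T1Space Y] (hf : IsQuotientMap f) (hcl : IsClosedMap f) : T2Space Y := by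
  refine ⟨fun y z hyz => ?_⟩
  obtain ⟨U, V, hU, hV, hyU, hzV, hUV⟩ := normal_separation
    ((isClosed_singleton (x := y)).preimage hf.continuous)
    ((isClosed_singleton (x := z)).preimage hf.continuous)
    (Disjoint.preimage f (by simpa using hyz))
  refine ⟨_, _, isOpen_kern hcl hU, isOpen_kern hcl hV, fun a ha => hyU ha, fun a ha => hzV ha, ?_⟩
  rw [Set.disjoint_left]
  intro w hw hw'
  obtain ⟨a, rfl⟩ := hf.surjective w
  exact Set.disjoint_left.1 hUV (hw rfl) (hw' rfl)

lemma secondCountable_of_closedMap [SecondCountableTopology X] [T1Space Y] (hf : IsQuotientMap f)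
    (hcl : IsClosedMap f) : SecondCountableTopology Y := by
  let B := TopologicalSpace.countableBasis X
  have hB : TopologicalSpace.IsTopologicalBasis B := TopologicalSpace.isBasis_countableBasis X
  have hBc : B.Countable := TopologicalSpace.countable_countableBasis X
  have hcount : {t : Set (Set X) | t.Finite ∧ t ⊆ B}.Countable :=
    countable_ofPred_finite_subset hBc
  have hopen : ∀ t ⊆ B, IsOpen (⋃₀ t) := fun t ht => isOpen_sUnion fun s hs => hB.isOpen (ht hs)
  have hbasis : TopologicalSpace.IsTopologicalBasis
      ((fun t => kernImage f (⋃₀ t)) '' {t : Set (Set X) | t.Finite ∧ t ⊆ B}) := by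
    refine TopologicalSpace.isTopologicalBasis_of_isOpen_of_nhds ?_ ?_
    · rintro _ ⟨t, ht, rfl⟩
      exact isOpen_kern hcl (hopen t ht.2)
    · intro y N hy hN
      have hc : IsCompact (f ⁻¹' {y}) :=
        ((isClosed_singleton (x := y)).preimage hf.continuous).isCompact
      have hNo : IsOpen (f ⁻¹' N) := hN.preimage hf.continuous
      obtain ⟨t, ht1, ht2, ht3, ht4⟩ : ∃ t : Set (Set X), t.Finite ∧ t ⊆ B ∧
          f ⁻¹' {y} ⊆ ⋃₀ t ∧ ⋃₀ t ⊆ f ⁻¹' N := by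
        refine hc.induction_on (p := fun s => ∃ t : Set (Set X), t.Finite ∧ t ⊆ B ∧
          s ⊆ ⋃₀ t ∧ ⋃₀ t ⊆ f ⁻¹' N) ?_ ?_ ?_ ?_
        · exact ⟨∅, by simp⟩
        · rintro s s' hs ⟨t, h1, h2, h3, h4⟩
          exact ⟨t, h1, h2, hs.trans h3, h4⟩
        · rintro s s' ⟨t, h1, h2, h3, h4⟩ ⟨t', h1', h2', h3', h4'⟩
          refine ⟨t ∪ t', h1.union h1', union_subset h2 h2', ?_, ?_⟩
          · rw [sUnion_union]
            exact union_subset_union h3 h3'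
          · rw [sUnion_union]
            exact union_subset h4 h4'
        · intro x hx
          have hxN : x ∈ f ⁻¹' N := by
            rw [mem_preimage, mem_singleton_iff] at hx
            rwa [mem_preimage, hx]
          obtain ⟨b, hb, hxb, hbN⟩ := hB.exists_subset_of_mem_open hxN hNo
          exact ⟨b, mem_nhdsWithin_of_mem_nhds ((hB.isOpen hb).mem_nhds hxb), {b}, by simp,
            by simpa using hb, by simp, by simpa using hbN⟩
      refine ⟨_, ⟨t, ⟨ht1, ht2⟩, rfl⟩, fun a ha => ht3 ha, ?_⟩
      intro w hw
      obtain ⟨a, rfl⟩ := hf.surjective w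
      exact ht4 (hw rfl)
  exact hbasis.secondCountableTopology (hcount.image _)

lemma preimage_connected (hX : HereditarilyUnicoherent X) (hf : IsQuotientMap f)
    (hr : ∀ a b, f a = f b ↔ rel a b) (hcl : IsClosedMap f) {A : Set Y} (hA : IsClosed A)
    (hAc : IsPreconnected A) : IsPreconnected (f ⁻¹' A) := by
  have hAX : IsClosed (f ⁻¹' A) := hA.preimage hf.continuous
  rw [isPreconnected_iff_subset_of_fully_disjoint_closed hAX]
  intro u v hu hv huv hd
  by_contra hcon
  push Not at hcon
  obtain ⟨h1, h2⟩ := hcon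
  obtain ⟨p, hpA, hpu⟩ := not_subset.1 h1
  obtain ⟨q, hqA, hqv⟩ := not_subset.1 h2
  have hpv := (huv hpA).resolve_left hpu
  have hqu := (huv hqA).resolve_right hqv
  obtain ⟨y, hyA, ⟨a, ⟨hau, haA⟩, rfl⟩, ⟨b, ⟨hbv, hbA⟩, hab⟩⟩ := isPreconnected_closed_iff.1 hAc
    _ _ (hcl _ (hu.inter hAX)) (hcl _ (hv.inter hAX)) (by
      intro y hy
      obtain ⟨a, rfl⟩ := hf.surjective y
      rcases huv hy with h | h
      · exact Or.inl ⟨a, ⟨h, hy⟩, rfl⟩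
      · exact Or.inr ⟨a, ⟨h, hy⟩, rfl⟩) ⟨f q, hqA, q, ⟨hqu, hqA⟩, rfl⟩
    ⟨f p, hpA, p, ⟨hpv, hpA⟩, rfl⟩
  obtain ⟨c, -, hcu, hcv⟩ := isPreconnected_closed_iff.1 (isPreconnected_class hX a) u v hu hv (by
    intro c hc
    have : f a = f c := (hr a c).2 hc
    exact huv (by rwa [mem_preimage, ← this])) ⟨a, (hr a a).1 rfl, hau⟩
    ⟨b, (hr a b).1 hab.symm, hbv⟩
  exact Set.disjoint_left.1 hd hcu hcv

lemma locConn (hX : HereditarilyUnicoherent X) (hf : IsQuotientMap f)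
    (hr : ∀ a b, f a = f b ↔ rel a b) (hcl : IsClosedMap f) [T2Space Y] [CompactSpace Y] :
    LocallyConnectedSpace Y := by
  rw [locallyConnectedSpace_iff_connected_subsets]
  intro y N hN
  obtain ⟨m, rfl⟩ := hf.surjective y
  obtain ⟨A, hAm, hAc, hAN⟩ := exists_mem_nhds_isClosed_subset hN
  obtain ⟨V, hVA, hV, hmV⟩ := mem_nhds_iff.1 hAm
  set F := f ⁻¹' A with hFdef
  have hF : IsClosed F := hAc.preimage hf.continuous
  have hVF : f ⁻¹' V ⊆ F := preimage_mono hVA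
  have hVo : IsOpen (f ⁻¹' V) := hV.preimage hf.continuous
  set C := connectedComponentIn F m with hC
  have hmF : m ∈ F := hVF hmV
  have hM : ∀ a, f a = f m → a ∈ C := by
    intro a ha
    have h1 : {a | rel m a} ⊆ F := by
      intro c hc
      have : f m = f c := (hr m c).2 hc
      rw [hFdef, mem_preimage, ← this]
      exact hmF
    exact (isPreconnected_class hX m).subset_connectedComponentIn ((hr m m).1 rfl) h1
      ((hr m a).1 ha.symm)
  have key : ∀ x, f x = f m → x ∈ interior C := by
    intro x hx
    by_contra hxC
    rw [mem_interior_iff_mem_nhds] at hxC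
    have hne : (𝓝[Cᶜ] x).NeBot := by
      rw [← mem_closure_iff_nhdsWithin_neBot, closure_compl, mem_compl_iff,
        mem_interior_iff_mem_nhds]
      exact hxC
    let U : Ultrafilter X := Ultrafilter.of (𝓝[Cᶜ] x)
    have hU : (U : Filter X) ≤ 𝓝[Cᶜ] x := Ultrafilter.of_le _
    have hUx : (U : Filter X) ≤ 𝓝 x := hU.trans nhdsWithin_le_nhds
    have hxV : x ∈ f ⁻¹' V := by rw [mem_preimage, hx]; exact hmV
    have ev1 : ∀ᶠ p in U, p ∈ f ⁻¹' V := hUx (hVo.mem_nhds hxV)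
    have ev2 : ∀ᶠ p in U, p ∈ Cᶜ := hU self_mem_nhdsWithin
    let D : X → Set X := fun p => connectedComponentIn F p
    have hxL : x ∈ ulim U D := mem_ulim U D id hUx
      (ev1.mono fun p hp => mem_connectedComponentIn (hVF hp))
    have hL : SubCtm (ulim U D) := ⟨(isClosed_ulim U D).isCompact, ⟨x, hxL⟩,
      isPreconnected_ulim U D (Filter.Eventually.of_forall fun p =>
        isPreconnected_connectedComponentIn)⟩
    have hLF : ulim U D ⊆ F := ulim_subset U D hF
      (Filter.Eventually.of_forall fun p => connectedComponentIn_subset F p)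
    have hLC : ulim U D ⊆ C := by
      rw [hC, connectedComponentIn_eq (hM x hx)]
      exact hL.2.2.subset_connectedComponentIn hxL hLF
    have hdisj : ∀ p, p ∈ f ⁻¹' V → p ∈ Cᶜ → ∀ q, q ∈ D p → q ∉ C := by
      intro p hpV hpC q hq hqC
      apply hpC
      have e1 : C = connectedComponentIn F q := connectedComponentIn_eq hqC
      have e2 : D p = connectedComponentIn F q := connectedComponentIn_eq hq
      rw [e1, ← e2]
      exact mem_connectedComponentIn (hVF hpV)
    have hempty : interior (ulim U D) = ∅ := by
      rw [eq_empty_iff_forall_notMem]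
      intro w hw
      obtain ⟨p, hpV, hpC, q, hq, hq'⟩ := (ev1.and (ev2.and
        (interior_subset hw _ (isOpen_interior.mem_nhds hw)))).exists
      exact hdisj p hpV hpC q hq (hLC (interior_subset hq'))
    have hmeet : ∀ᶠ p in U, (D p ∩ (f ⁻¹' V)ᶜ).Nonempty := by
      filter_upwards [ev1, ev2] with p hpV hpC
      by_cases hVu : f ⁻¹' V = univ
      · exfalso
        apply hpC
        have hFu : F = univ := univ_subset_iff.1 (hVu ▸ hVF)
        rw [hC, hFu, connectedComponentIn_univ, PreconnectedSpace.connectedComponent_eq_univ]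
        trivial
      · obtain ⟨E, hE, hpE, hEs, hEQ⟩ := bump (J := univ) (Q := (f ⁻¹' V)ᶜ) (b := p)
          ⟨isCompact_univ, isConnected_univ⟩ hVo.isClosed_compl (mem_univ _) (fun h => h hpV)
          (by rw [univ_inter]; exact nonempty_compl.2 hVu)
        refine hEQ.mono (inter_subset_inter_left _ ?_)
        refine hE.2.2.subset_connectedComponentIn hpE (hEs.trans (closure_minimal ?_ hF))
        intro q hq
        exact hVF (not_not.1 hq.2)
    obtain ⟨q, hqL, hqV⟩ := ulim_meets U D hVo.isClosed_compl hmeet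
    apply hqV
    have : f x = f q := (hr x q).2 (rel_of_subset hL hxL hqL hempty)
    rw [mem_preimage, ← this]
    exact hxV
  refine ⟨f '' C, ?_, ?_, ?_⟩
  · refine Filter.mem_of_superset ((isOpen_kern hcl (isOpen_interior (s := C))).mem_nhds
      (fun a ha => key a ha)) ?_
    intro w hw
    obtain ⟨a, rfl⟩ := hf.surjective w
    exact ⟨a, interior_subset (hw rfl), rfl⟩
  · exact isPreconnected_connectedComponentIn.image f hf.continuous.continuousOn
  · rintro _ ⟨a, ha, rfl⟩
    exact hAN (connectedComponentIn_subset F m ha)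

lemma noCircle (hX : HereditarilyUnicoherent X) (hf : IsQuotientMap f)
    (hr : ∀ a b, f a = f b ↔ rel a b) (hcl : IsClosedMap f) [T2Space Y] (S : Set Y) :
    ¬ Nonempty (S ≃ₜ Circle) := by
  rintro ⟨e⟩
  let g : ℝ → Y := fun t => (e.symm (Circle.exp t) : Y)
  have hg : Continuous g :=
    continuous_subtype_val.comp (e.symm.continuous.comp Circle.exp.continuous)
  have hgi : ∀ s t, g s = g t → ∃ m : ℤ, s = t + m * (2 * Real.pi) := by
    intro s t hst
    exact Circle.exp_eq_exp.1 (e.symm.injective (Subtype.val_injective hst))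
  have hpi := Real.pi_pos
  have arc : ∀ a b : ℝ, a ≤ b → IsCompact (g '' Icc a b) ∧ IsConnected (g '' Icc a b) :=
    fun a b hab => ⟨isCompact_Icc.image hg, (isConnected_Icc hab).image g hg.continuousOn⟩
  have arcX : ∀ a b : ℝ, a ≤ b → SubCtm (f ⁻¹' (g '' Icc a b)) := fun a b hab =>
    ⟨((arc a b hab).1.isClosed.preimage hf.continuous).isCompact,
      (arc a b hab).2.1.preimage hf.surjective,
      preimage_connected hX hf hr hcl (arc a b hab).1.isClosed (arc a b hab).2.2⟩
  have hA := arcX 0 Real.pi hpi.le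
  have hB := arcX Real.pi (2 * Real.pi) (by linarith)
  have hAB := (hX _ _ hA.1 hA.2 hB.1 hB.2).image f hf.continuous.continuousOn
  rw [← preimage_inter, image_preimage_eq _ hf.surjective] at hAB
  have hg2 : g (2 * Real.pi) = g 0 := by
    have : Circle.exp (2 * Real.pi) = Circle.exp 0 := Circle.exp_eq_exp.2 ⟨1, by push_cast; ring⟩
    simp only [g, this]
  obtain ⟨w, -, hw1, hw2⟩ := isPreconnected_closed_iff.1 hAB {g 0} {g Real.pi} isClosed_singleton
    isClosed_singleton (by
      rintro _ ⟨⟨s, hs, rfl⟩, t, ht, hts⟩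
      obtain ⟨m, hm⟩ := hgi _ _ hts
      rcases le_or_gt m 0 with h | h
      · right
        have h' : (m : ℝ) ≤ 0 := by exact_mod_cast h
        have : s = Real.pi := by nlinarith [hs.1, hs.2, ht.1, ht.2]
        rw [this]
        rfl
      · left
        have h' : (1 : ℝ) ≤ m := by exact_mod_cast h
        have : s = 0 := by nlinarith [hs.1, hs.2, ht.1, ht.2]
        rw [this]
        rfl)
    ⟨g 0, ⟨⟨0, ⟨le_rfl, hpi.le⟩, rfl⟩, 2 * Real.pi, ⟨by linarith, le_rfl⟩, hg2⟩, rfl⟩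
    ⟨g Real.pi, ⟨⟨Real.pi, ⟨hpi.le, le_rfl⟩, rfl⟩, Real.pi, ⟨le_rfl, by linarith⟩, rfl⟩, rfl⟩
  obtain ⟨m, hm⟩ := hgi 0 Real.pi (by rw [← mem_singleton_iff.1 hw1, mem_singleton_iff.1 hw2])
  have h1 : (0 : ℝ) = Real.pi * (1 + 2 * m) := by linarith
  rcases mul_eq_zero.1 h1.symm with h | h
  · exact hpi.ne' h
  · have : (1 + 2 * m : ℤ) = 0 := by exact_mod_cast h
    omega

end Aux

/-- If every indecomposable subcontinuum of a hereditarily unicoherent continuum is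
nowhere dense, then the quotient space by the partition into meager composants is a
dendrite. -/
theorem meagerComposant_quotient_dendrite (X : Type) [MetricSpace X] [CompactSpace X] [ConnectedSpace X] [Nonempty X]
    (hX : HereditarilyUnicoherent X)
    (hind : ∀ K : Set X, IsCompact K → IsConnected K → IndecomposableSet K →
      IsNowhereDense K) :
    IsDendriteSpace (Quot (fun a b : X => b ∈ MeagerComposant X a)) := by
  have hD : Decomp X := by
    intro J hJ hne
    by_contra hcon
    have h1 := hind J hJ.1 hJ.2 (by
      rintro ⟨H, K, hH, hH', hK, hK', -, -, h3, h4, h5⟩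
      exact hcon ⟨H, K, ⟨hH, hH'⟩, ⟨hK, hK'⟩, h3, h4, h5⟩)
    rw [IsNowhereDense, hJ.isClosed.closure_eq] at h1
    exact hne.ne_empty h1
  have hmem : ∀ a b : X, b ∈ MeagerComposant X a ↔ rel a b := by
    intro a b
    constructor
    · rintro ⟨L, ⟨h1, h2, h3, h4⟩, h5⟩
      refine rel_of_subset ⟨h1, h2⟩ h4 h5 ?_
      rwa [IsNowhereDense, h1.isClosed.closure_eq] at h3
    · intro h
      have hc := cont_irr hX a b
      refine ⟨irr a b, ⟨hc.1, hc.2, ?_, left_mem_irr _ _⟩, right_mem_irr _ _⟩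
      rw [IsNowhereDense, hc.isClosed.closure_eq]
      exact h
  have heqv : Equivalence (fun a b : X => b ∈ MeagerComposant X a) :=
    ⟨fun a => (hmem a a).2 (rel_refl hD a), fun h => (hmem _ _).2 (rel_symm ((hmem _ _).1 h)),
      fun h h' => (hmem _ _).2 (rel_trans hX ((hmem _ _).1 h) ((hmem _ _).1 h'))⟩
  have hf : IsQuotientMap (Quot.mk (fun a b : X => b ∈ MeagerComposant X a)) := isQuotientMap_quot_mk
  have hr : ∀ a b : X, Quot.mk (fun a b : X => b ∈ MeagerComposant X a) a = Quot.mk _ b ↔ rel a b :=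
    fun a b => (heqv.quot_mk_eq_iff a b).trans (hmem a b)
  have hcl := closedMap hX hD hf hr
  have hT1 : T1Space (Quot (fun a b : X => b ∈ MeagerComposant X a)) := by
    refine ⟨fun y => ?_⟩
    obtain ⟨a, rfl⟩ := hf.surjective y
    simpa using hcl _ (isClosed_singleton (x := a))
  have hT2 := t2_of_closedMap hf hcl
  have hsc := secondCountable_of_closedMap hf hcl
  exact ⟨Nonempty.map (Quot.mk _) inferInstance, inferInstance,
    hf.surjective.connectedSpace hf.continuous, inferInstance, locConn hX hf hr hcl,
    noCircle hX hf hr hcl⟩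
end

section
/- If X is a hereditarily unicoherent continuum, then the number of meager composants of X is either 1 or exactly 2^{ℵ₀} (the cardinality of the continuum). -/
open Set Topology

namespace MC

/-- A subcontinuum. -/
def Cont {X : Type} [TopologicalSpace X] (L : Set X) : Prop := IsCompact L ∧ IsConnected L

/-- The smallest continuum containing `p` and `q`. -/
def Irr {X : Type} [TopologicalSpace X] (p q : X) : Set X :=
  ⋂₀ {L : Set X | Cont L ∧ p ∈ L ∧ q ∈ L}

theorem Irr_subset {X : Type} [TopologicalSpace X] {p q : X} {L : Set X} (h : Cont L)
    (hp : p ∈ L) (hq : q ∈ L) : Irr p q ⊆ L := sInter_subset_of_mem ⟨h, hp, hq⟩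

theorem left_mem_Irr {X : Type} [TopologicalSpace X] (p q : X) : p ∈ Irr p q :=
  fun _ h => h.2.1

theorem right_mem_Irr {X : Type} [TopologicalSpace X] (p q : X) : q ∈ Irr p q :=
  fun _ h => h.2.2

theorem Cont.union {X : Type} [TopologicalSpace X] {A B : Set X} (hA : Cont A) (hB : Cont B)
    (h : (A ∩ B).Nonempty) : Cont (A ∪ B) :=
  ⟨hA.1.union hB.1, hA.2.union h hB.2⟩

theorem Irr_cont {X : Type} [TopologicalSpace X] [T2Space X] [CompactSpace X] [ConnectedSpace X]
    (hX : HereditarilyUnicoherent X) (p q : X) : Cont (Irr p q) := by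
  have hclosed : IsClosed (Irr p q) := isClosed_sInter fun L hL => hL.1.1.isClosed
  refine ⟨hclosed.isCompact, ⟨p, left_mem_Irr p q⟩, ?_⟩
  rw [isPreconnected_closed_iff]
  intro t t' ht ht' hsub h1 h2
  by_contra hne
  have hdisj : Disjoint (Irr p q ∩ t) (Irr p q ∩ t') := by
    rw [Set.disjoint_left]
    intro a ha hb
    exact hne ⟨a, ha.1, ha.2, hb.2⟩
  obtain ⟨u, v, hu, hv, hau, hbv, huv⟩ := SeparatedNhds.of_isCompact_isCompact
    (hclosed.inter ht).isCompact (hclosed.inter ht').isCompact hdisj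
  have hex : ∃ L : Set X, (Cont L ∧ p ∈ L ∧ q ∈ L) ∧ L ⊆ u ∪ v := by
    let ι := {L : Set X // Cont L ∧ p ∈ L ∧ q ∈ L}
    have : Nonempty ι := ⟨⟨univ, ⟨isCompact_univ, isConnected_univ⟩, trivial, trivial⟩⟩
    have := exists_subset_nhds_of_isCompact' (ι := ι) (V := fun i => i.1) (U := u ∪ v) ?_
      (fun i => i.2.1.1) (fun i => i.2.1.1.isClosed) ?_
    · obtain ⟨i, hi⟩ := this
      exact ⟨i.1, i.2, hi⟩
    · intro A B
      refine ⟨⟨A.1 ∩ B.1, ⟨A.2.1.1.inter B.2.1.1, ⟨p, A.2.2.1, B.2.2.1⟩,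
        hX _ _ A.2.1.1 A.2.1.2 B.2.1.1 B.2.1.2⟩, ⟨A.2.2.1, B.2.2.1⟩, ⟨A.2.2.2, B.2.2.2⟩⟩, ?_, ?_⟩
      · exact inter_subset_left
      · exact inter_subset_right
    · intro x hx
      apply (hu.union hv).mem_nhds
      have hxJ : x ∈ Irr p q := by
        intro L hL
        exact mem_iInter.1 hx ⟨L, hL⟩
      rcases hsub hxJ with h | h
      · exact Or.inl (hau ⟨hxJ, h⟩)
      · exact Or.inr (hbv ⟨hxJ, h⟩)
  obtain ⟨L, hL, hLuv⟩ := hex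
  obtain ⟨a, ha⟩ := h1
  obtain ⟨b, hb⟩ := h2
  obtain ⟨c, hc⟩ := hL.1.2.isPreconnected u v hu hv hLuv ⟨a, ha.1 L hL, hau ha⟩
    ⟨b, hb.1 L hL, hbv hb⟩
  exact Set.disjoint_left.1 huv hc.2.1 hc.2.2

/-- Boundary bumping. -/
theorem bump {X : Type} [TopologicalSpace X] [T2Space X] [CompactSpace X] [ConnectedSpace X]
    {V : Set X} (hV : IsOpen V) (hne : V.Nonempty) {p : X} (hp : p ∉ V) :
    ∃ C : Set X, Cont C ∧ p ∈ C ∧ Disjoint C V ∧ (C ∩ closure V).Nonempty := by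
  have : CompactSpace (Vᶜ : Set X) := isCompact_iff_compactSpace.1 hV.isClosed_compl.isCompact
  let p' : (Vᶜ : Set X) := ⟨p, hp⟩
  refine ⟨Subtype.val '' connectedComponent p', ⟨?_, ?_⟩, ⟨p', mem_connectedComponent, rfl⟩, ?_, ?_⟩
  · exact isClosed_connectedComponent.isCompact.image continuous_subtype_val
  · exact isConnected_connectedComponent.image _ continuous_subtype_val.continuousOn
  · rw [Set.disjoint_left]
    rintro _ ⟨a, _, rfl⟩
    exact a.2
  · by_contra hemp
    have hO : IsOpen (Subtype.val ⁻¹' (closure V)ᶜ : Set (Vᶜ : Set X)) :=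
      isClosed_closure.isOpen_compl.preimage continuous_subtype_val
    have hZ : ∃ Z : Set (Vᶜ : Set X), (IsClopen Z ∧ p' ∈ Z) ∧
        Z ⊆ Subtype.val ⁻¹' (closure V)ᶜ := by
      let ι := {Z : Set (Vᶜ : Set X) // IsClopen Z ∧ p' ∈ Z}
      have : Nonempty ι := ⟨⟨univ, isClopen_univ, trivial⟩⟩
      have := exists_subset_nhds_of_isCompact' (ι := ι) (V := fun i => i.1)
        (U := Subtype.val ⁻¹' (closure V)ᶜ) ?_
        (fun i => i.2.1.1.isCompact) (fun i => i.2.1.1) ?_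
      · obtain ⟨i, hi⟩ := this
        exact ⟨i.1, i.2, hi⟩
      · intro A B
        exact ⟨⟨A.1 ∩ B.1, A.2.1.inter B.2.1, A.2.2, B.2.2⟩, inter_subset_left,
          inter_subset_right⟩
      · intro x hx
        apply hO.mem_nhds
        have hxc : x ∈ connectedComponent p' := by
          rw [connectedComponent_eq_iInter_isClopen]
          exact hx
        intro hxV
        exact hemp ⟨x.1, ⟨x, hxc, rfl⟩, hxV⟩
    obtain ⟨Z, ⟨hZc, hpZ⟩, hZs⟩ := hZ
    have hcl : IsClosed (Subtype.val '' Z) :=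
      (hZc.1.isCompact.image continuous_subtype_val).isClosed
    have hop : IsOpen (Subtype.val '' Z) := by
      obtain ⟨G, hG, hGZ⟩ := isOpen_induced_iff.1 hZc.2
      have : Subtype.val '' Z = G ∩ (closure V)ᶜ := by
        ext a
        constructor
        · rintro ⟨b, hb, rfl⟩
          refine ⟨?_, hZs hb⟩
          rw [← hGZ] at hb
          exact hb
        · rintro ⟨ha, hb⟩
          refine ⟨⟨a, fun h => hb (subset_closure h)⟩, ?_, rfl⟩
          rw [← hGZ]
          exact ha
      rw [this]
      exact hG.inter isClosed_closure.isOpen_compl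
    have huniv := IsClopen.eq_univ ⟨hcl, hop⟩ ⟨p, p', hpZ, rfl⟩
    obtain ⟨v, hv⟩ := hne
    have hvZ : v ∈ Subtype.val '' Z := by rw [huniv]; trivial
    obtain ⟨b, hb, hbv⟩ := hvZ
    exact b.2 (hbv ▸ hv)

/-- `Rel B p q`: some continuum missing `B` contains both points. -/
def Rel {X : Type} [TopologicalSpace X] (B : Set X) (p q : X) : Prop :=
  ∃ L : Set X, Cont L ∧ Disjoint L B ∧ p ∈ L ∧ q ∈ L

theorem Rel_iff {X : Type} [TopologicalSpace X] [T2Space X] [CompactSpace X]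
    {B : Set X} (hB : IsOpen B) (p q : X) :
    Rel B p q ↔ ∃ (p' q' : (Bᶜ : Set X)), p'.1 = p ∧ q'.1 = q ∧
      (p' : ConnectedComponents (Bᶜ : Set X)) = q' := by
  have : CompactSpace (Bᶜ : Set X) := isCompact_iff_compactSpace.1 hB.isClosed_compl.isCompact
  constructor
  · rintro ⟨L, hL, hd, hp, hq⟩
    have hLB : L ⊆ Bᶜ := fun a ha hb => Set.disjoint_left.1 hd ha hb
    refine ⟨⟨p, hLB hp⟩, ⟨q, hLB hq⟩, rfl, rfl, ?_⟩
    rw [ConnectedComponents.coe_eq_coe']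
    have hpre : IsPreconnected (Subtype.val ⁻¹' L : Set (Bᶜ : Set X)) := by
      rw [← Topology.IsInducing.subtypeVal.isPreconnected_image, Subtype.image_preimage_coe,
        inter_eq_right.2 hLB]
      exact hL.2.2
    exact hpre.subset_connectedComponent hq hp
  · rintro ⟨p', q', rfl, rfl, h⟩
    rw [ConnectedComponents.coe_eq_coe'] at h
    refine ⟨Subtype.val '' connectedComponent q', ⟨?_, ?_⟩, ?_, ⟨p', h, rfl⟩,
      ⟨q', mem_connectedComponent, rfl⟩⟩
    · exact isClosed_connectedComponent.isCompact.image continuous_subtype_val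
    · exact isConnected_connectedComponent.image _ continuous_subtype_val.continuousOn
    · rw [Set.disjoint_left]
      rintro _ ⟨a, _, rfl⟩
      exact a.2

theorem Rel_closed {X : Type} [TopologicalSpace X] [T2Space X] [CompactSpace X]
    {B : Set X} (hB : IsOpen B) : IsClosed {z : X × X | Rel B z.1 z.2} := by
  have : CompactSpace (Bᶜ : Set X) := isCompact_iff_compactSpace.1 hB.isClosed_compl.isCompact
  have : {z : X × X | Rel B z.1 z.2} = (fun z : (Bᶜ : Set X) × (Bᶜ : Set X) => (z.1.1, z.2.1)) ''
      {z | (z.1 : ConnectedComponents (Bᶜ : Set X)) = z.2} := by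
    ext ⟨a, b⟩
    change Rel B a b ↔ _
    rw [Rel_iff hB]
    constructor
    · rintro ⟨p', q', rfl, rfl, h⟩
      exact ⟨(p', q'), h, rfl⟩
    · rintro ⟨⟨p', q'⟩, h, h2⟩
      rw [Prod.mk.injEq] at h2
      exact ⟨p', q', h2.1, h2.2, h⟩
  rw [this]
  apply IsCompact.isClosed
  apply IsCompact.image _ (by fun_prop)
  apply IsClosed.isCompact
  exact isClosed_eq (ConnectedComponents.continuous_coe.comp continuous_fst)
    (ConnectedComponents.continuous_coe.comp continuous_snd)

/-- The section of `Rel` is a continuum. -/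
theorem Rel_section {X : Type} [TopologicalSpace X] [T2Space X] [CompactSpace X]
    {B : Set X} (hB : IsOpen B) {x y : X} (h : Rel B x y) : Cont {z | Rel B x z} := by
  have hcl : IsClosed {z | Rel B x z} :=
    (Rel_closed hB).preimage (f := fun z : X => (x, z)) (by fun_prop)
  obtain ⟨L₀, hL₀, hd₀, hx₀, -⟩ := h
  refine ⟨hcl.isCompact, ⟨x, L₀, hL₀, hd₀, hx₀, hx₀⟩, ?_⟩
  apply isPreconnected_of_forall x
  rintro z ⟨L, hL, hd, hx, hz⟩
  exact ⟨L, fun w hw => ⟨L, hL, hd, hx, hw⟩, hx, hz, hL.2.2⟩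

theorem Rel.symm {X : Type} [TopologicalSpace X] {B : Set X} {x y : X} (h : Rel B x y) :
    Rel B y x := by
  obtain ⟨L, hL, hd, hx, hz⟩ := h
  exact ⟨L, hL, hd, hz, hx⟩

theorem Rel.refl_left {X : Type} [TopologicalSpace X] {B : Set X} {x y : X} (h : Rel B x y) :
    Rel B x x := by
  obtain ⟨L, hL, hd, hx, hz⟩ := h
  exact ⟨L, hL, hd, hx, hx⟩

theorem mem_MC_iff {X : Type} [TopologicalSpace X] {x y : X} :
    y ∈ MeagerComposant X x ↔ ∃ L, Cont L ∧ IsNowhereDense L ∧ x ∈ L ∧ y ∈ L := by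
  constructor
  · rintro ⟨L, ⟨h1, h2, h3, h4⟩, h5⟩
    exact ⟨L, ⟨h1, h2⟩, h3, h4, h5⟩
  · rintro ⟨L, ⟨h1, h2⟩, h3, h4, h5⟩
    exact ⟨L, ⟨h1, h2, h3, h4⟩, h5⟩

theorem nd_union {X : Type} [TopologicalSpace X] {A B : Set X} (hA : IsNowhereDense A)
    (hB : IsNowhereDense B) : IsNowhereDense (A ∪ B) := by
  unfold IsNowhereDense at *
  rw [closure_union, interior_union_isClosed_of_interior_empty isClosed_closure hB, hA]

theorem MC_eq {X : Type} [TopologicalSpace X] {x y : X}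
    (h : y ∈ MeagerComposant X x) : MeagerComposant X x = MeagerComposant X y := by
  obtain ⟨L, hL, hn, hx, hy⟩ := mem_MC_iff.1 h
  ext z
  constructor
  · intro hz
    obtain ⟨M, hM, hm, hx', hz⟩ := mem_MC_iff.1 hz
    exact mem_MC_iff.2 ⟨L ∪ M, hL.union hM ⟨x, hx, hx'⟩, nd_union hn hm, Or.inl hy, Or.inr hz⟩
  · intro hz
    obtain ⟨M, hM, hm, hx', hz⟩ := mem_MC_iff.1 hz
    exact mem_MC_iff.2 ⟨L ∪ M, hL.union hM ⟨y, hy, hx'⟩, nd_union hn hm, Or.inl hx, Or.inr hz⟩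

theorem interior_Irr_subset {X : Type} [TopologicalSpace X] [T2Space X] [CompactSpace X]
    [ConnectedSpace X] (hX : HereditarilyUnicoherent X) {p x y : X}
    (h : y ∈ MeagerComposant X x) : interior (Irr p x) ⊆ Irr p y := by
  obtain ⟨L, hL, hn, hx, hy⟩ := mem_MC_iff.1 h
  have hJ := Irr_cont hX p y
  have hs : Irr p x ⊆ Irr p y ∪ L := Irr_subset (hJ.union hL ⟨y, right_mem_Irr p y, hy⟩)
    (Or.inl (left_mem_Irr p y)) (Or.inr hx)
  intro a ha
  by_contra hna
  have hop : IsOpen (interior (Irr p x) \ Irr p y) := isOpen_interior.sdiff hJ.1.isClosed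
  have : interior (Irr p x) \ Irr p y ⊆ interior (closure L) := by
    apply interior_maximal _ hop
    rintro b ⟨hb, hb'⟩
    rcases hs (interior_subset hb) with h | h
    · exact absurd h hb'
    · exact subset_closure h
  rw [hn] at this
  exact this ⟨ha, hna⟩

theorem exists_Rel {X : Type} [TopologicalSpace X] [T2Space X] {b : Set (Set X)}
    (hb : TopologicalSpace.IsTopologicalBasis b) {x y : X}
    (h : y ∈ MeagerComposant X x) {B : Set X} (hB : IsOpen B) (hne : B.Nonempty) :
    ∃ m ∈ b, m.Nonempty ∧ m ⊆ B ∧ Rel m x y := by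
  obtain ⟨L, hL, hn, hx, hy⟩ := mem_MC_iff.1 h
  have hopen : IsOpen (B \ L) := hB.sdiff hL.1.isClosed
  have hne' : (B \ L).Nonempty := by
    by_contra hemp
    rw [not_nonempty_iff_eq_empty, sdiff_eq_empty] at hemp
    have : B ⊆ interior (closure L) := interior_maximal (hemp.trans subset_closure) hB
    rw [hn] at this
    obtain ⟨a, ha⟩ := hne
    exact this ha
  obtain ⟨a, ha⟩ := hne'
  obtain ⟨m, hm, ham, hmB⟩ := hb.exists_subset_of_mem_open ha hopen
  exact ⟨m, hm, ⟨a, ham⟩, fun z hz => (hmB hz).1, L, hL,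
    Set.disjoint_left.2 fun z hz hzm => (hmB hzm).2 hz, hx, hy⟩

theorem meagre_one {X : Type} [MetricSpace X] [CompactSpace X] [ConnectedSpace X]
    (hX : HereditarilyUnicoherent X) (p x : X) :
    IsMeagre (MeagerComposant X x ∩ interior (Irr p x)) := by
  by_contra hnm
  set W := interior (Irr p x) with hW
  have hWo : IsOpen W := isOpen_interior
  set b := TopologicalSpace.countableBasis X
  have hb : TopologicalSpace.IsTopologicalBasis b := TopologicalSpace.isBasis_countableBasis X
  have hbc : b.Countable := TopologicalSpace.countable_countableBasis X
  set B₀ := interior (closure (MeagerComposant X x ∩ W)) with hB₀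
  have hB₀ne : B₀.Nonempty := by
    rw [nonempty_iff_ne_empty]
    intro h
    exact hnm (IsNowhereDense.isMeagre h)
  have hBne : (B₀ ∩ W).Nonempty := by
    obtain ⟨a, ha⟩ := hB₀ne
    obtain ⟨c, hc1, hc2⟩ := mem_closure_iff.1 (interior_subset ha) B₀ isOpen_interior ha
    exact ⟨c, hc1, hc2.2⟩
  have hBo : IsOpen (B₀ ∩ W) := isOpen_interior.inter hWo
  set I : Set (Set X) := {m | m ∈ b ∧ m.Nonempty ∧ m ⊆ B₀ ∩ W}
  have hcov : MeagerComposant X x ∩ W ⊆ ⋃ m ∈ I, ({y | Rel m x y} ∩ W) := by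
    rintro y ⟨hy, hyW⟩
    obtain ⟨m, hm, hmne, hmB, hR⟩ := exists_Rel hb hy hBo hBne
    exact mem_biUnion (show m ∈ I from ⟨hm, hmne, hmB⟩) ⟨hR, hyW⟩
  obtain ⟨m, ⟨hmb, hmne, hmB⟩, hmm⟩ := exists_of_not_isMeagre_biUnion
    (hbc.mono fun m hm => hm.1 : I.Countable) (fun h => hnm (h.mono hcov))
  have hmo : IsOpen m := hb.isOpen hmb
  obtain ⟨y₀, hy₀⟩ := nonempty_of_not_isMeagre hmm
  have hL : Cont {y | Rel m x y} := Rel_section hmo hy₀.1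
  have hxL : x ∈ {y | Rel m x y} := hy₀.1.refl_left
  set L := {y | Rel m x y} with hLdef
  have hLm : ∀ z ∈ L, z ∉ m := by
    rintro z ⟨K, hK, hd, -, hz⟩ hzm
    exact Set.disjoint_left.1 hd hz hzm
  have hpL : p ∉ L := by
    intro hpL
    obtain ⟨a, ha⟩ := hmne
    exact hLm a (Irr_subset hL hpL hxL (interior_subset (hmB ha).2)) ha
  -- the open set inside `L`
  have hG : (interior L ∩ W).Nonempty := by
    by_contra hemp
    apply hmm
    apply IsNowhereDense.isMeagre
    rw [isNowhereDense_iff_disjoint, Set.disjoint_left]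
    rintro a ⟨ha, haW⟩ hai
    apply hemp
    refine ⟨a, ?_, haW⟩
    refine interior_mono ?_ hai
    exact closure_minimal inter_subset_left hL.1.isClosed
  obtain ⟨g, hg⟩ := hG
  obtain ⟨N, hN, hNc, hNs⟩ := exists_mem_nhds_isClosed_subset
    ((isOpen_interior.inter hWo).mem_nhds hg)
  have hVo : IsOpen (interior N) := isOpen_interior
  have hgV : g ∈ interior N := mem_interior_iff_mem_nhds.2 hN
  have hVcl : closure (interior N) ⊆ interior L ∩ W :=
    (closure_minimal interior_subset hNc).trans hNs
  have hpV : p ∉ interior N := fun h => hpL (interior_subset (hVcl (subset_closure h)).1)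
  obtain ⟨C, hC, hpC, hCV, ⟨c, hcC, hcV⟩⟩ := bump hVo ⟨g, hgV⟩ hpV
  obtain ⟨y, hym, hy⟩ : ∃ y ∈ m, y ∈ MeagerComposant X x ∩ W := by
    obtain ⟨a, ha⟩ := hmne
    obtain ⟨c, hc1, hc2⟩ := mem_closure_iff.1 (interior_subset (hmB ha).1) m hmo ha
    exact ⟨c, hc1, hc2⟩
  have hCL : Irr p x ⊆ C ∪ L :=
    Irr_subset (hC.union hL ⟨c, hcC, interior_subset (hVcl hcV).1⟩) (Or.inl hpC) (Or.inr hxL)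
  have hyC : y ∈ C := by
    rcases hCL (interior_subset hy.2) with h | h
    · exact h
    · exact absurd hym (hLm y h)
  have hgC : g ∈ C := Irr_subset hC hpC hyC (interior_Irr_subset hX hy.1 hg.2)
  exact Set.disjoint_left.1 hCV hgC hgV

theorem Irr_comm {X : Type} [TopologicalSpace X] (p q : X) : Irr p q = Irr q p := by
  unfold Irr
  congr 1
  ext L
  constructor
  · rintro ⟨h, hp, hq⟩
    exact ⟨h, hq, hp⟩
  · rintro ⟨h, hp, hq⟩
    exact ⟨h, hq, hp⟩

theorem meagre_two {X : Type} [MetricSpace X] [CompactSpace X] [ConnectedSpace X]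
    (hX : HereditarilyUnicoherent X) (p q x : X) :
    IsMeagre (MeagerComposant X x ∩ interior (Irr p q)) := by
  have h1 := meagre_one hX p x
  have h2 := meagre_one hX q x
  have hc := Irr_cont hX p x
  have h3 : IsMeagre (frontier (Irr p x)) := by
    apply IsNowhereDense.isMeagre
    rw [isClosed_frontier.isNowhereDense_iff]
    exact interior_frontier hc.1.isClosed
  refine ((h1.union h2).union h3).mono ?_
  rintro y ⟨hy, hyU⟩
  by_cases hyp : y ∈ Irr p x
  · by_cases hyi : y ∈ interior (Irr p x)
    · exact Or.inl (Or.inl ⟨hy, hyi⟩)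
    · exact Or.inr ⟨subset_closure hyp, hyi⟩
  · refine Or.inl (Or.inr ⟨hy, ?_⟩)
    have hs : Irr p q ⊆ Irr p x ∪ Irr q x :=
      Irr_subset (hc.union (Irr_cont hX q x) ⟨x, right_mem_Irr _ _, right_mem_Irr _ _⟩)
        (Or.inl (left_mem_Irr _ _)) (Or.inr (left_mem_Irr _ _))
    have hop : IsOpen (interior (Irr p q) \ Irr p x) := isOpen_interior.sdiff hc.1.isClosed
    refine interior_maximal ?_ hop ⟨hyU, hyp⟩
    rintro a ⟨ha, ha'⟩
    exact (hs (interior_subset ha)).resolve_left ha'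

theorem meagre_rel {X : Type} [MetricSpace X] [CompactSpace X] [ConnectedSpace X]
    (hX : HereditarilyUnicoherent X) {U : Set X} (hU : IsOpen U)
    (hm : ∀ x, IsMeagre (MeagerComposant X x ∩ U)) :
    IsMeagre {z : X × X | z.2 ∈ MeagerComposant X z.1 ∧ z.1 ∈ U ∧ z.2 ∈ U} := by
  set b := {m ∈ TopologicalSpace.countableBasis X | m.Nonempty} with hbdef
  have hb : TopologicalSpace.IsTopologicalBasis (TopologicalSpace.countableBasis X) :=
    TopologicalSpace.isBasis_countableBasis X
  have hbc : b.Countable := (TopologicalSpace.countable_countableBasis X).mono fun m hm => hm.1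
  have hbo : ∀ m ∈ b, IsOpen m := fun m hm => hb.isOpen hm.1
  have : Countable b := hbc
  set R : Set X → Set (X × X) := fun m => {z | Rel m z.1 z.2} with hR
  have hRc : ∀ m ∈ b, IsClosed (R m) := fun m hm => Rel_closed (hbo m hm)
  set Q : Set X → Set (X × X) := fun n => ⋃ m ∈ {m ∈ b | m ⊆ n}, interior (R m) with hQ
  have hQo : ∀ n, IsOpen (Q n) := fun n => isOpen_biUnion fun m _ => isOpen_interior
  have hmeag : IsMeagre (⋃ m ∈ b, frontier (R m)) := by
    apply isMeagre_biUnion hbc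
    intro m hm
    apply IsNowhereDense.isMeagre
    rw [isClosed_frontier.isNowhereDense_iff]
    exact interior_frontier (hRc m hm)
  -- the points in all `Q n` are equivalent
  have hQE : ∀ z : X × X, (∀ n ∈ b, z ∈ Q n) → z.2 ∈ MeagerComposant X z.1 := by
    intro z hz
    have hc := Irr_cont hX z.1 z.2
    refine mem_MC_iff.2 ⟨Irr z.1 z.2, hc, ?_, left_mem_Irr _ _, right_mem_Irr _ _⟩
    rw [hc.1.isClosed.isNowhereDense_iff, eq_empty_iff_forall_notMem]
    intro a ha
    obtain ⟨n, hn, han, hns⟩ := hb.exists_subset_of_mem_open ha isOpen_interior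
    obtain ⟨m, ⟨hm, hmn⟩, hzm⟩ := mem_iUnion₂.1 (hz n ⟨hn, ⟨a, han⟩⟩)
    obtain ⟨L, hL, hd, h1, h2⟩ := interior_subset hzm
    obtain ⟨c, hcm⟩ := hm.2
    exact Set.disjoint_left.1 hd (Irr_subset hL h1 h2 (interior_subset (hns (hmn hcm)))) hcm
  set T : Set (X × X) := {z | (∀ n ∈ b, z ∈ Q n) ∧ z.1 ∈ U ∧ z.2 ∈ U} with hT
  have hTn : IsNowhereDense T := by
    rw [IsNowhereDense, eq_empty_iff_forall_notMem]
    intro z hz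
    obtain ⟨z', hz'i, hz'T⟩ := mem_closure_iff.1 (interior_subset hz) _ isOpen_interior hz
    -- a box
    have hop : IsOpen (interior (closure T) ∩ (U ×ˢ U)) := isOpen_interior.inter (hU.prod hU)
    obtain ⟨V, V', hV, hV', hzV, hzV', hVV⟩ := isOpen_prod_iff.1 hop z'.1 z'.2
      ⟨hz'i, hz'T.2.1, hz'T.2.2⟩
    have hdense : ∀ O O' : Set X, IsOpen O → IsOpen O' → O ⊆ V → O' ⊆ V' → O.Nonempty →
        O'.Nonempty → ∀ n ∈ b, ∃ x ∈ O, ∃ y ∈ O', (x, y) ∈ Q n := by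
      rintro O O' hO hO' hOV hOV' ⟨x, hx⟩ ⟨y, hy⟩ n hn
      have hcl : (x, y) ∈ closure T := interior_subset (hVV ⟨hOV hx, hOV' hy⟩).1
      obtain ⟨w, ⟨hw1, hw2⟩, hwT⟩ := mem_closure_iff.1 hcl _ (hO.prod hO') ⟨hx, hy⟩
      exact ⟨w.1, hw1, w.2, hw2, hwT.1 n hn⟩
    -- generic first coordinate
    have hVU : ∀ x ∈ V, ∀ y ∈ V', x ∈ U ∧ y ∈ U := fun x hx y hy => (hVV (mk_mem_prod hx hy)).2
    let b' : Set (Set X) := {k ∈ b | k ⊆ V'}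
    have hb'c : Countable b' := (hbc.mono fun m hm => hm.1 : b'.Countable)
    have h1 : Dense (⋂ i : b × b', ({x | ∃ y ∈ i.2.1, (x, y) ∈ Q i.1.1} ∪ (closure V)ᶜ)) := by
      apply dense_iInter_of_isOpen
      · rintro ⟨⟨n, hn⟩, ⟨k, hk⟩⟩
        apply IsOpen.union _ isClosed_closure.isOpen_compl
        have : {x | ∃ y ∈ k, (x, y) ∈ Q n} = Prod.fst '' ((univ ×ˢ k) ∩ Q n) := by
          ext x
          constructor
          · rintro ⟨y, hy, hxy⟩
            exact ⟨(x, y), ⟨⟨trivial, hy⟩, hxy⟩, rfl⟩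
          · rintro ⟨⟨x', y⟩, ⟨⟨-, hy⟩, hxy⟩, rfl⟩
            exact ⟨y, hy, hxy⟩
        change IsOpen {x | ∃ y ∈ k, (x, y) ∈ Q n}
        rw [this]
        exact isOpenMap_fst _ ((isOpen_univ.prod (hbo k hk.1)).inter (hQo n))
      · rintro ⟨⟨n, hn⟩, ⟨k, hk⟩⟩
        rw [dense_iff_inter_open]
        rintro O hO ⟨x, hx⟩
        by_cases hxV : x ∈ closure V
        · obtain ⟨x', hx'O, hx'V⟩ := mem_closure_iff.1 hxV O hO hx
          obtain ⟨x₁, hx₁, y, hy, hxy⟩ := hdense (O ∩ V) k (hO.inter hV) (hbo k hk.1)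
            inter_subset_right hk.2 ⟨x', hx'O, hx'V⟩ hk.1.2 n hn
          exact ⟨x₁, hx₁.1, Or.inl ⟨y, hy, hxy⟩⟩
        · exact ⟨x, hx, Or.inr hxV⟩
    obtain ⟨x, hxV, hx⟩ := dense_iff_inter_open.1 h1 V hV ⟨_, hzV⟩
    have hx' : ∀ n ∈ b, ∀ k ∈ b', ∃ y ∈ k, (x, y) ∈ Q n := by
      intro n hn k hk
      rcases mem_iInter.1 hx (⟨n, hn⟩, ⟨k, hk⟩) with h | h
      · exact h
      · exact absurd (subset_closure hxV) h
    -- generic second coordinate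
    have h2 : (⋂ n : b, ({y | (x, y) ∈ Q n.1} ∪ (closure V')ᶜ)) ∈ residual X := by
      rw [countable_iInter_mem]
      rintro ⟨n, hn⟩
      apply residual_of_dense_open
      · exact ((hQo n).preimage (f := fun y : X => (x, y)) (by fun_prop)).union
          isClosed_closure.isOpen_compl
      · rw [dense_iff_inter_open]
        rintro O hO ⟨y, hy⟩
        by_cases hyV : y ∈ closure V'
        · obtain ⟨y', hy'O, hy'V⟩ := mem_closure_iff.1 hyV O hO hy
          obtain ⟨k, hk, hyk, hks⟩ := hb.exists_subset_of_mem_open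
            (show y' ∈ O ∩ V' from ⟨hy'O, hy'V⟩) (hO.inter hV')
          obtain ⟨w, hw, hxw⟩ := hx' n hn k ⟨⟨hk, ⟨y', hyk⟩⟩, fun a ha => (hks ha).2⟩
          exact ⟨w, (hks hw).1, Or.inl hxw⟩
        · exact ⟨y, hy, Or.inr hyV⟩
    obtain ⟨y, hyV, hy⟩ := dense_iff_inter_open.1
      (dense_of_mem_residual (Filter.inter_mem h2 (hm x))) V' hV' ⟨_, hzV'⟩
    apply hy.2
    refine ⟨?_, (hVU x hxV y hyV).2⟩
    apply hQE (x, y)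
    intro n hn
    rcases mem_iInter.1 hy.1 ⟨n, hn⟩ with h | h
    · exact h
    · exact absurd (subset_closure hyV) h
  refine (hmeag.union hTn.isMeagre).mono ?_
  rintro z ⟨hz, hzU⟩
  by_cases hall : ∀ n ∈ b, z ∈ Q n
  · exact Or.inr ⟨hall, hzU⟩
  · left
    push Not at hall
    obtain ⟨n, hn, hzn⟩ := hall
    obtain ⟨m, hm, hmne, hmn, hrel⟩ := exists_Rel hb hz (hbo n hn) hn.2
    refine mem_biUnion (show m ∈ b from ⟨hm, hmne⟩) ⟨subset_closure hrel, fun hi => hzn ?_⟩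
    exact mem_biUnion (show m ∈ {m ∈ b | m ⊆ n} from ⟨⟨hm, hmne⟩, hmn⟩) hi

theorem unif_cantor {X : Type} [MetricSpace X] {f : (ℕ → Bool) → X} (hf : Continuous f)
    {ε : ℝ} (hε : 0 < ε) :
    ∃ N : ℕ, ∀ a b : ℕ → Bool, (∀ i < N, a i = b i) → dist (f a) (f b) < ε := by
  let _ : MetricSpace (ℕ → Bool) :=
    PiNat.metricSpaceOfDiscreteUniformity (E := fun _ => Bool) fun _ => rfl
  have hu : UniformContinuous f := CompactSpace.uniformContinuous_of_continuous hf
  obtain ⟨δ, hδ, h⟩ := Metric.uniformContinuous_iff.1 hu ε hε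
  obtain ⟨N, hN⟩ := exists_pow_lt_of_lt_one hδ (by norm_num : (1 / 2 : ℝ) < 1)
  refine ⟨N, fun a b hab => h (lt_of_le_of_lt ?_ hN)⟩
  exact PiNat.mem_cylinder_iff_dist_le.1 (PiNat.mem_cylinder_iff.2 hab)

theorem perturb {X : Type} [MetricSpace X] {ι : Type} [Fintype ι] [DecidableEq ι]
    {O : Set (X × X)} (ho : IsOpen O) (hd : Dense O) :
    Dense {x : ι → X | ∀ i j, i ≠ j → (x i, x j) ∈ O} := by
  have heq : {x : ι → X | ∀ i j, i ≠ j → (x i, x j) ∈ O} =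
      ⋂₀ (range fun k : {k : ι × ι // k.1 ≠ k.2} => {x : ι → X | (x k.1.1, x k.1.2) ∈ O}) := by
    ext x
    simp only [sInter_range, mem_iInter]
    exact ⟨fun h k => h _ _ k.2, fun h i j hij => h ⟨(i, j), hij⟩⟩
  rw [heq]
  apply Set.Finite.dense_sInter (finite_range _)
  · rintro _ ⟨k, rfl⟩
    exact ho.preimage (f := fun x : ι → X => (x k.1.1, x k.1.2)) (by fun_prop)
  · rintro _ ⟨⟨⟨i, j⟩, hij⟩, rfl⟩
    rw [Metric.dense_iff]
    intro x r hr
    obtain ⟨⟨a, b⟩, hab, habO⟩ := Metric.dense_iff.1 hd (x i, x j) r hr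
    rw [Metric.mem_ball, Prod.dist_eq, max_lt_iff] at hab
    refine ⟨Function.update (Function.update x i a) j b, ?_, ?_⟩
    · rw [Metric.mem_ball, dist_pi_lt_iff hr]
      intro k
      by_cases hkj : k = j
      · subst hkj
        simpa using hab.2
      · by_cases hki : k = i
        · subst hki
          simpa [hkj] using hab.1
        · simpa [hkj, hki] using hr
    · have hij' : i ≠ j := hij
      simpa [hij'] using habO

theorem mycielski {X : Type} [MetricSpace X] [CompactSpace X] {U : Set X} (hU : IsOpen U)
    (hne : U.Nonempty) {E : Set (X × X)} (hE : IsMeagre {z : X × X | z ∈ E ∧ z.1 ∈ U ∧ z.2 ∈ U}) :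
    ∃ f : (ℕ → Bool) → X, ∀ a b, a ≠ b → (f a, f b) ∉ E := by
  obtain ⟨S, hSo, hSd, hSc, hS⟩ := mem_residual_iff.1 hE
  have : Countable S := hSc
  let D : S × ℕ → Set C(ℕ → Bool, X) := fun k =>
    {f | MapsTo (fun z : (ℕ → Bool) × (ℕ → Bool) => (f z.1, f z.2)) {z | z.1 k.2 ≠ z.2 k.2} k.1.1}
  have hDd : Dense (⋂ k, D k) := by
    apply dense_iInter_of_isOpen
    · rintro ⟨⟨O, hO⟩, i⟩
      let Φ : C(ℕ → Bool, X) → C((ℕ → Bool) × (ℕ → Bool), X × X) :=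
        fun f => (f.comp ContinuousMap.fst).prodMk (f.comp ContinuousMap.snd)
      have hΦ : Continuous Φ := by
        apply ContinuousMap.continuous_of_continuous_uncurry
        change Continuous fun z : C(ℕ → Bool, X) × ((ℕ → Bool) × (ℕ → Bool)) =>
          (z.1 z.2.1, z.1 z.2.2)
        fun_prop
      have hK : IsCompact {z : (ℕ → Bool) × (ℕ → Bool) | z.1 i ≠ z.2 i} := by
        apply IsClosed.isCompact
        have : IsClosed ((fun z : (ℕ → Bool) × (ℕ → Bool) => (z.1 i, z.2 i)) ⁻¹'
            {w : Bool × Bool | w.1 ≠ w.2}) :=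
          (isClosed_discrete _).preimage (by fun_prop)
        exact this
      exact (ContinuousMap.isOpen_setOfPred_mapsTo hK (hSo O hO)).preimage hΦ
    · rintro ⟨⟨O, hO⟩, i⟩
      rw [Metric.dense_iff]
      intro f r hr
      obtain ⟨N₀, hN₀⟩ := unif_cantor f.continuous (half_pos (half_pos hr))
      let N := max N₀ (i + 1)
      let ext : (Fin N → Bool) → (ℕ → Bool) := fun s n => if h : n < N then s ⟨n, h⟩ else false
      let res : (ℕ → Bool) → (Fin N → Bool) := fun a n => a n
      have hres : Continuous res := by
        refine continuous_pi fun n => continuous_apply _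
      obtain ⟨x, hxb, hx⟩ := Metric.dense_iff.1
        (perturb (ι := Fin N → Bool) (hSo O hO) (hSd O hO)) (fun s => f (ext s)) (r / 2 / 2)
        (half_pos (half_pos hr))
      rw [Metric.mem_ball, dist_pi_lt_iff (half_pos (half_pos hr))] at hxb
      refine ⟨⟨fun a => x (res a), (continuous_of_discreteTopology (f := x)).comp hres⟩, ?_, ?_⟩
      · rw [Metric.mem_ball]
        refine lt_of_le_of_lt ((ContinuousMap.dist_le (half_pos hr).le).2 ?_) (half_lt_self hr)
        intro a
        have h1 := hxb (res a)
        have h2 : dist (f (ext (res a))) (f a) < r / 2 / 2 := by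
          apply hN₀
          intro j hj
          have : j < N := lt_of_lt_of_le hj (le_max_left _ _)
          simp [ext, res, this]
        have h3 := dist_triangle (x (res a)) (f (ext (res a))) (f a)
        change dist (x (res a)) (f a) ≤ r / 2
        linarith
      · rintro ⟨a, b⟩ hab
        apply hx
        intro h
        apply hab
        exact congrFun h ⟨i, lt_of_lt_of_le (Nat.lt_succ_self i) (le_max_right _ _)⟩
  have hUo : IsOpen {f : C(ℕ → Bool, X) | MapsTo f univ U} :=
    ContinuousMap.isOpen_setOfPred_mapsTo isCompact_univ hU
  obtain ⟨u, hu⟩ := hne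
  obtain ⟨f, hfU, hf⟩ := dense_iff_inter_open.1 hDd _ hUo
    ⟨ContinuousMap.const _ u, fun _ _ => hu⟩
  refine ⟨f, fun a b hab hEab => ?_⟩
  obtain ⟨i, hi⟩ := Function.ne_iff.1 hab
  have hmem : (f a, f b) ∈ ⋂₀ S := by
    intro O hO
    exact mem_iInter.1 hf (⟨O, hO⟩, i) (show (a, b) ∈ {z : (ℕ → Bool) × (ℕ → Bool) | z.1 i ≠ z.2 i} from hi)
  exact hS hmem ⟨hEab, hfU trivial, hfU trivial⟩

theorem self_mem {X : Type} [MetricSpace X] [ConnectedSpace X] [Nontrivial X] (x : X) :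
    x ∈ MeagerComposant X x := by
  refine mem_MC_iff.2 ⟨{x}, ⟨isCompact_singleton, isConnected_singleton⟩, ?_, rfl, rfl⟩
  rw [isClosed_singleton.isNowhereDense_iff]
  exact interior_singleton x

end MC

/-- A hereditarily unicoherent continuum has either `1` or `2 ^ ℵ₀` meager composants. -/
theorem card_meagerComposants (X : Type) [MetricSpace X] [CompactSpace X] [ConnectedSpace X] [Nonempty X]
    (hX : HereditarilyUnicoherent X) :
    Cardinal.mk {S : Set X | ∃ x : X, S = MeagerComposant X x} = 1 ∨
      Cardinal.mk {S : Set X | ∃ x : X, S = MeagerComposant X x} = Cardinal.continuum := by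
  by_cases hall : ∀ p q : X, MeagerComposant X p = MeagerComposant X q
  · left
    obtain ⟨x₀⟩ := ‹Nonempty X›
    have : {S : Set X | ∃ x : X, S = MeagerComposant X x} = {MeagerComposant X x₀} := by
      ext S
      constructor
      · rintro ⟨x, rfl⟩
        exact hall x x₀
      · rintro rfl
        exact ⟨x₀, rfl⟩
    rw [this, Cardinal.mk_singleton]
  · right
    push Not at hall
    obtain ⟨p, q, hpq⟩ := hall
    have : Nontrivial X := ⟨⟨p, q, fun h => hpq (by rw [h])⟩⟩
    have hc := MC.Irr_cont hX p q
    have hUne : (interior (MC.Irr p q)).Nonempty := by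
      rw [nonempty_iff_ne_empty]
      intro h
      apply hpq
      apply MC.MC_eq
      exact MC.mem_MC_iff.2 ⟨_, hc, hc.1.isClosed.isNowhereDense_iff.2 h,
        MC.left_mem_Irr p q, MC.right_mem_Irr p q⟩
    obtain ⟨f, hf⟩ := MC.mycielski (E := {z : X × X | z.2 ∈ MeagerComposant X z.1})
      isOpen_interior hUne (MC.meagre_rel hX isOpen_interior fun x => MC.meagre_two hX p q x)
    apply le_antisymm
    · have h1 : Cardinal.mk {S : Set X | ∃ x : X, S = MeagerComposant X x} ≤ Cardinal.mk X :=
        Cardinal.mk_le_of_surjective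
          (f := fun x : X => (⟨MeagerComposant X x, x, rfl⟩ :
            {S : Set X | ∃ x : X, S = MeagerComposant X x}))
          (by rintro ⟨_, x, rfl⟩; exact ⟨x, rfl⟩)
      refine h1.trans ?_
      obtain ⟨g, -, hg⟩ := PolishSpace.exists_nat_nat_continuous_surjective X
      refine (Cardinal.mk_le_of_surjective hg).trans ?_
      simp
    · have h2 : Cardinal.mk (ℕ → Bool) = Cardinal.continuum := by simp
      rw [← h2]
      refine Cardinal.mk_le_of_injective
        (f := fun a => (⟨MeagerComposant X (f a), f a, rfl⟩ :
            {S : Set X | ∃ x : X, S = MeagerComposant X x})) ?_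
      intro a b hab
      by_contra hne
      apply hf a b hne
      have h3 : MeagerComposant X (f a) = MeagerComposant X (f b) := congrArg Subtype.val hab
      change f b ∈ MeagerComposant X (f a)
      rw [h3]
      exact MC.self_mem (f b)
end

section
/- Every tree-like continuum has either exactly 1 or exactly 2^{ℵ₀} meager composants. -/
open Set Topology

namespace MC

/-- Disjoint closed cover of a preconnected closed set. -/
theorem pre_split {α : Type*} [TopologicalSpace α] {s u v : Set α} (hs : IsPreconnected s)
    (hu : IsClosed u) (hv : IsClosed v) (h : s ⊆ u ∪ v) (hd : s ∩ (u ∩ v) = ∅) :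
    s ⊆ u ∨ s ⊆ v :=
  isPreconnected_iff_subset_of_disjoint_closed.1 hs u v hu hv h hd

theorem pre_of {α : Type*} [TopologicalSpace α] {s : Set α} (hc : IsClosed s)
    (h : ∀ u v : Set α, IsClosed u → IsClosed v → u ∪ v = s → u ∩ v = ∅ →
      u.Nonempty → v.Nonempty → False) : IsPreconnected s := by
  rw [isPreconnected_iff_subset_of_disjoint_closed]
  intro u v hu hv hs hd
  by_contra hcon
  push Not at hcon
  obtain ⟨h1, h2⟩ := hcon
  obtain ⟨x, hx, hxu⟩ := not_subset.1 h1
  obtain ⟨y, hy, hyv⟩ := not_subset.1 h2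
  refine h (s ∩ u) (s ∩ v) (hc.inter hu) (hc.inter hv) ?_ ?_ ⟨y, hy, (hs hy).resolve_right hyv⟩
    ⟨x, hx, (hs hx).resolve_left hxu⟩
  · rw [← inter_union_distrib_left]; exact inter_eq_left.2 hs
  · rw [← hd]; ext z; simp; tauto

/-- closed `A`, `B` with connected union and intersection are connected. -/
theorem pre_left {α : Type*} [TopologicalSpace α] {A B : Set α} (hA : IsClosed A)
    (hB : IsClosed B) (hU : IsPreconnected (A ∪ B)) (hI : IsPreconnected (A ∩ B)) :
    IsPreconnected A := by
  have key : ∀ u v : Set α, IsClosed u → IsClosed v → u ∪ v = A → u ∩ v = ∅ →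
      u.Nonempty → v.Nonempty → A ∩ B ⊆ u → False := by
    intro u v hu hv huv hd ⟨x, hx⟩ ⟨y, hy⟩ hs
    have hdis : ∀ z, z ∈ u → z ∈ v → False := fun z h1 h2 => by
      have : z ∈ u ∩ v := ⟨h1, h2⟩
      rw [hd] at this; exact this
    have hvB : ∀ z, z ∈ v → z ∈ B → False := fun z h1 h2 =>
      hdis z (hs ⟨huv ▸ Or.inr h1, h2⟩) h1
    rcases pre_split hU (hu.union hB) hv (by rw [← huv]; intro z; simp; tauto) (by
      ext z; simp only [mem_inter_iff, mem_union, mem_empty_iff_false, iff_false]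
      rintro ⟨_, h1 | h1, h2⟩
      · exact hdis z h1 h2
      · exact hvB z h2 h1) with h | h
    · rcases h (Or.inl (show y ∈ A from huv ▸ Or.inr hy)) with h | h
      · exact hdis y h hy
      · exact hvB y hy h
    · exact hdis x hx (h (Or.inl (show x ∈ A from huv ▸ Or.inl hx)))
  refine pre_of hA fun u v hu hv huv hd hun hvn => ?_
  rcases pre_split hI hu hv (by rw [huv]; exact inter_subset_left) (by rw [hd]; simp) with h | h
  · exact key u v hu hv huv hd hun hvn h
  · exact key v u hv hu (by rw [union_comm]; exact huv) (by rw [inter_comm]; exact hd) hvn hun h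

/-- cut point data -/
structure Cut {α : Type*} [TopologicalSpace α] (x : α) (U V : Set α) : Prop where
  oU : IsOpen U
  oV : IsOpen V
  nU : U.Nonempty
  nV : V.Nonempty
  cov : U ∪ V = {x}ᶜ
  dis : U ∩ V = ∅

theorem Cut.symm {α : Type*} [TopologicalSpace α] {x : α} {U V : Set α} (h : Cut x U V) :
    Cut x V U :=
  ⟨h.oV, h.oU, h.nV, h.nU, by rw [union_comm]; exact h.cov, by rw [inter_comm]; exact h.dis⟩

theorem Cut.mem {α : Type*} [TopologicalSpace α] {x : α} {U V : Set α} (h : Cut x U V) (y : α) :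
    (y ∈ U ∧ y ∉ V ∧ y ≠ x) ∨ (y ∈ V ∧ y ∉ U ∧ y ≠ x) ∨ (y = x ∧ y ∉ U ∧ y ∉ V) := by
  have h1 := Set.ext_iff.1 h.cov y
  have h2 := Set.ext_iff.1 h.dis y
  simp at h1 h2
  tauto

theorem Cut.pre {α : Type*} [TopologicalSpace α] [T1Space α] [PreconnectedSpace α] {x : α}
    {U V : Set α} (h : Cut x U V) : IsPreconnected Uᶜ := by
  apply pre_left (B := Vᶜ) h.oU.isClosed_compl h.oV.isClosed_compl
  · rw [← compl_inter, h.dis, compl_empty]; exact isPreconnected_univ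
  · rw [← compl_union, h.cov, compl_compl]; exact isPreconnected_singleton

theorem Cut.sub {α : Type*} [TopologicalSpace α] {x : α} {U V : Set α} (h : Cut x U V)
    {S : Set α} (hS : IsPreconnected S) (hx : x ∉ S) {y : α} (hy : y ∈ S) (hyU : y ∈ U) :
    S ⊆ U := by
  have := isPreconnected_iff_subset_of_disjoint.1 hS U V h.oU h.oV
    (fun z hz => by
      have := h.mem z
      have : z ≠ x := fun e => hx (e ▸ hz)
      simp; tauto) (by rw [h.dis]; simp)
  rcases this with h' | h'
  · exact h'
  · have := h.mem y
    have := h' hy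
    tauto

theorem exists_cut {α : Type*} [TopologicalSpace α] [T1Space α] {x : α}
    (h : ¬ IsPreconnected ({x}ᶜ : Set α)) : ∃ U V, Cut x U V := by
  rw [isPreconnected_iff_subset_of_disjoint] at h
  push Not at h
  obtain ⟨u, v, hu, hv, hs, hd, h1, h2⟩ := h
  obtain ⟨a, ha, hau⟩ := not_subset.1 h1
  obtain ⟨b, hb, hbv⟩ := not_subset.1 h2
  have ho : IsOpen ({x}ᶜ : Set α) := isOpen_compl_singleton
  refine ⟨{x}ᶜ ∩ u, {x}ᶜ ∩ v, ho.inter hu, ho.inter hv, ⟨b, hb, (hs hb).resolve_right hbv⟩,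
    ⟨a, ha, (hs ha).resolve_left hau⟩, ?_, ?_⟩
  · rw [← inter_union_distrib_left]; exact inter_eq_left.2 hs
  · rw [← hd]; ext z; simp; tauto

theorem chain_dir {α : Type*} {c : Set (Set α)} (h : IsChain (· ⊆ ·) c) :
    DirectedOn (· ⊇ ·) c := by
  intro a ha b hb
  rcases h.total ha hb with h' | h'
  · exact ⟨a, ha, subset_rfl, h'⟩
  · exact ⟨b, hb, h', subset_rfl⟩

/-- every branch at a cut point holds a non-cut point -/
theorem exists_noncut {α : Type*} [TopologicalSpace α] [T2Space α] [CompactSpace α]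
    [PreconnectedSpace α] {x : α} {U V : Set α} (h : Cut x U V) :
    ∃ e ∈ V, IsPreconnected ({e}ᶜ : Set α) := by
  by_contra hcon
  push Not at hcon
  have hch : ∀ v : V, ∃ A B : Set α, Cut v.1 A B ∧ x ∈ A := by
    intro v
    obtain ⟨A, B, hAB⟩ := exists_cut (hcon v v.2)
    have h1 := hAB.mem x
    have h2 := h.mem v
    rcases h1 with h1 | h1 | h1
    · exact ⟨A, B, hAB, h1.1⟩
    · exact ⟨B, A, hAB.symm, h1.1⟩
    · exfalso
      have := h1.1
      have := v.2
      have : v.1 ≠ x := by tauto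
      exact this h1.1.symm
  choose A B hAB hxA using hch
  have hsub : ∀ v, (A v)ᶜ ⊆ V := by
    intro v
    have : Vᶜ ⊆ A v := (hAB v).sub (h.symm.pre) (by simp) (y := x) (by
      have := h.mem x; simp; tauto) (hxA v)
    exact compl_subset_comm.1 this
  have hstep : ∀ v w : V, w.1 ∈ B v → (A w)ᶜ ⊆ B v := by
    intro v w hw
    have : (B v)ᶜ ⊆ A w := (hAB w).sub ((hAB v).symm.pre) (by simpa using hw) (y := x) (by
      have := (hAB v).mem x
      have := hxA v
      simp; tauto) (hxA w)
    exact compl_subset_comm.1 this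
  have hself : ∀ v : V, v.1 ∈ (A v)ᶜ := fun v => by
    have := (hAB v).mem v.1
    simp; tauto
  obtain ⟨m, hm⟩ := zorn_superset (Set.range fun v : V => (A v)ᶜ) (by
    intro c hc hchain
    rcases c.eq_empty_or_nonempty with rfl | hne
    · obtain ⟨v, hv⟩ := h.nV
      exact ⟨(A ⟨v, hv⟩)ᶜ, ⟨_, rfl⟩, by simp⟩
    have : Nonempty c := hne.to_subtype
    have hclo : ∀ s ∈ c, IsClosed s := by
      intro s hs
      obtain ⟨v, rfl⟩ := hc hs
      exact (hAB v).oU.isClosed_compl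
    obtain ⟨w, hw⟩ := IsCompact.nonempty_sInter_of_directed_nonempty_isCompact_isClosed
      (S := c) ((chain_dir hchain)) (by
        intro s hs
        obtain ⟨v, rfl⟩ := hc hs
        exact ⟨_, hself v⟩) (fun s hs => (hclo s hs).isCompact) hclo
    have hwV : w ∈ V := by
      obtain ⟨s, hs⟩ := hne
      obtain ⟨v, rfl⟩ := hc hs
      exact hsub v (hw _ hs)
    refine ⟨(A ⟨w, hwV⟩)ᶜ, ⟨_, rfl⟩, fun s hs => ?_⟩
    obtain ⟨v, rfl⟩ := hc hs
    have hwv := hw _ hs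
    have h3 := (hAB v).mem w
    by_cases hwe : w = v.1
    · have : (⟨w, hwV⟩ : V) = v := Subtype.ext hwe
      rw [this]
    · have hwB : w ∈ B v := by
        simp at hwv; tauto
      refine (hstep v ⟨w, hwV⟩ hwB).trans fun z hz => ?_
      have := (hAB v).mem z
      simp; tauto)
  obtain ⟨⟨v, rfl⟩, hmin⟩ := hm
  obtain ⟨w, hw⟩ := (hAB v).nV
  have hwV : w ∈ V := hsub v (by have := (hAB v).mem w; simp; tauto)
  have h1 := hstep v ⟨w, hwV⟩ hw
  have h2 : (A v)ᶜ ⊆ (A ⟨w, hwV⟩)ᶜ := hmin ⟨_, rfl⟩ (h1.trans fun z hz => by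
    have := (hAB v).mem z
    simp; tauto)
  have h3 := h1 (h2 (hself v))
  have := (hAB v).mem v.1
  tauto

theorem pre_sInter {α : Type*} [TopologicalSpace α] [T2Space α] [CompactSpace α]
    {S : Set (Set α)} (hne : S.Nonempty) (hd : DirectedOn (· ⊇ ·) S)
    (hc : ∀ s ∈ S, IsClosed s) (hp : ∀ s ∈ S, IsPreconnected s) : IsPreconnected (⋂₀ S) := by
  refine pre_of (isClosed_sInter hc) fun u v hu hv huv hdis hun hvn => ?_
  obtain ⟨U, V, hU, hV, huU, hvV, hUV⟩ := normal_separation hu hv (Set.disjoint_iff_inter_eq_empty.2 hdis)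
  have : Nonempty S := hne.to_subtype
  obtain ⟨s, hs⟩ := exists_subset_nhds_of_isCompact (V := fun s : S => s.1)
    (directedOn_iff_directed.1 hd) (fun s => (hc s s.2).isCompact) (U := U ∪ V) (fun x hx => by
      rw [← sInter_eq_iInter, ← huv] at hx
      exact (hU.union hV).mem_nhds (hx.imp (fun h => huU h) (fun h => hvV h)))
  have hsub : u ∪ v ⊆ s.1 := by rw [huv]; exact sInter_subset_of_mem s.2
  rcases isPreconnected_iff_subset_of_disjoint.1 (hp s s.2) U V hU hV hs
    (by rw [hUV.inter_eq]; simp) with h | h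
  · obtain ⟨x, hx⟩ := hvn
    exact hUV.le_bot ⟨h (hsub (Or.inr hx)), hvV hx⟩
  · obtain ⟨x, hx⟩ := hun
    exact hUV.le_bot ⟨huU hx, h (hsub (Or.inl hx))⟩

theorem exists_irred {α : Type*} [TopologicalSpace α] [T2Space α] [CompactSpace α]
    {A : Set α} (hA : IsClosed A) (hAp : IsPreconnected A) {p q : α} (hp : p ∈ A) (hq : q ∈ A) :
    ∃ C ⊆ A, IsClosed C ∧ IsPreconnected C ∧ p ∈ C ∧ q ∈ C ∧
      ∀ D ⊆ C, IsClosed D → IsPreconnected D → p ∈ D → q ∈ D → D = C := by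
  obtain ⟨m, hmA, hm⟩ := zorn_superset_nonempty
    {C : Set α | IsClosed C ∧ IsPreconnected C ∧ p ∈ C ∧ q ∈ C} (by
      intro c hc hchain hne
      refine ⟨⋂₀ c, ⟨isClosed_sInter fun s hs => (hc hs).1, ?_, fun s hs => (hc hs).2.2.1,
        fun s hs => (hc hs).2.2.2⟩, fun s hs => sInter_subset_of_mem hs⟩
      exact pre_sInter hne (chain_dir hchain) (fun s hs => (hc hs).1)
        (fun s hs => (hc hs).2.1)) A ⟨hA, hAp, hp, hq⟩
  obtain ⟨⟨h1, h2, h3, h4⟩, hmin⟩ := hm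
  exact ⟨m, hmA, h1, h2, h3, h4, fun D hD a b c d => hD.antisymm (hmin ⟨a, b, c, d⟩ hD)⟩

theorem hu_of_finite_noncut {α : Type*} [TopologicalSpace α] [T2Space α] [CompactSpace α]
    [PreconnectedSpace α] (hfin : {t : α | IsPreconnected ({t}ᶜ : Set α)}.Finite)
    {A B : Set α} (hA : IsClosed A) (hAp : IsPreconnected A) (hB : IsClosed B)
    (hBp : IsPreconnected B) : IsPreconnected (A ∩ B) := by
  refine pre_of (hA.inter hB) fun P Q hP hQ hPQ hd ⟨p, hp⟩ ⟨q, hq⟩ => ?_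
  have hpAB : p ∈ A ∩ B := hPQ ▸ Or.inl hp
  have hqAB : q ∈ A ∩ B := hPQ ▸ Or.inr hq
  obtain ⟨C, hCA, hC, hCp, hpC, hqC, hmin⟩ := exists_irred hA hAp hpAB.1 hqAB.1
  -- C \ B infinite
  have hinf : (C \ B).Infinite := by
    intro hf
    have hCB : C ⊆ B := by
      rcases pre_split hCp hB hf.isClosed (fun z hz => by simp; tauto)
        (by ext z; simp) with h | h
      · exact h
      · exact absurd hpAB.2 (h hpC).2
    rcases pre_split hCp hP hQ (by rw [hPQ]; exact fun z hz => ⟨hCA hz, hCB hz⟩)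
      (by rw [hd]; simp) with h | h
    · have : q ∈ P ∩ Q := ⟨h hqC, hq⟩
      rw [hd] at this; exact this
    · have : p ∈ P ∩ Q := ⟨hp, h hpC⟩
      rw [hd] at this; exact this
  have hinf2 : ((C \ B) \ {t : α | IsPreconnected ({t}ᶜ : Set α)}).Infinite := hinf.sdiff hfin
  have hch : ∀ x : ((C \ B) \ {t : α | IsPreconnected ({t}ᶜ : Set α)} : Set α),
      ∃ U V : Set α, Cut x.1 U V ∧ C ⊆ Vᶜ := by
    rintro ⟨x, ⟨hxC, hxB⟩, hx⟩
    obtain ⟨U, V, hUV, hpU⟩ : ∃ U V, Cut x U V ∧ p ∈ U := by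
      obtain ⟨U, V, hUV⟩ := exists_cut hx
      have hpx : p ≠ x := fun e => hxB (e ▸ hpAB.2)
      rcases hUV.mem p with h | h | h
      · exact ⟨U, V, hUV, h.1⟩
      · exact ⟨V, U, hUV.symm, h.1⟩
      · exact absurd h.1 hpx
    refine ⟨U, V, hUV, ?_⟩
    have hBU : B ⊆ U := hUV.sub hBp hxB hpAB.2 hpU
    have hpre : IsPreconnected (C ∩ Vᶜ) := by
      apply pre_left (B := C ∩ Uᶜ) (hC.inter hUV.oV.isClosed_compl) (hC.inter hUV.oU.isClosed_compl)
      · rw [← inter_union_distrib_left, ← compl_inter, inter_comm V, hUV.dis]; simpa using hCp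
      · rw [← inter_inter_distrib_left, ← compl_union, union_comm, hUV.cov, compl_compl]
        exact (subsingleton_singleton.anti inter_subset_right).isPreconnected
    have hm := hmin _ inter_subset_left (hC.inter hUV.oV.isClosed_compl) hpre
      ⟨hpC, by have := hUV.mem p; simp; tauto⟩
      ⟨hqC, by have := hUV.mem q; have := hBU hqAB.2; simp; tauto⟩
    rw [← hm]; exact inter_subset_right
  choose U V hUV hCV using hch
  choose e heV he using fun x => exists_noncut (hUV x)
  have hinj : Function.Injective e := by
    intro x y hxy
    by_contra hne
    have hne' : x.1 ≠ y.1 := fun h => hne (Subtype.ext h)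
    have hsub : (U y)ᶜ ⊆ U x := (hUV x).sub (hUV y).pre (by
        have := (hUV y).mem x.1
        have := hCV y x.2.1.1
        simp at this ⊢; tauto) (y := y.1) (by
        have := (hUV y).mem y.1
        simp; tauto) (by
        have := (hUV x).mem y.1
        have := hCV x y.2.1.1
        simp at this
        have := hne'.symm
        tauto)
    have h1 : e y ∈ U x := hsub (by
      have := (hUV y).mem (e y)
      have := heV y
      simp; tauto)
    have := (hUV x).mem (e y)
    have h2 := heV x
    rw [hxy] at h2
    tauto
  have : Infinite ((C \ B) \ {t : α | IsPreconnected ({t}ᶜ : Set α)} : Set α) := hinf2.to_subtype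
  exact (infinite_range_of_injective hinj) (hfin.subset (by rintro _ ⟨x, rfl⟩; exact he x))

end MC

namespace MC

theorem hu_of_treeLike {X : Type} [MetricSpace X] [CompactSpace X] (hX : TreeLike X)
    {A B : Set X} (hA : IsClosed A) (hAp : IsPreconnected A) (hB : IsClosed B)
    (hBp : IsPreconnected B) : IsPreconnected (A ∩ B) := by
  refine pre_of (hA.inter hB) fun P Q hP hQ hPQ hd ⟨p, hp⟩ ⟨q, hq⟩ => ?_
  have hpAB : p ∈ A ∩ B := hPQ ▸ Or.inl hp
  have hqAB : q ∈ A ∩ B := hPQ ▸ Or.inr hq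
  obtain ⟨δ, hδ, hdis⟩ := (Set.disjoint_iff_inter_eq_empty.2 hd).exists_cthickenings
    hP.isCompact hQ
  obtain ⟨δ2, hδ2, hdis2⟩ := hdis.exists_thickenings
    Metric.isClosed_cthickening.isCompact Metric.isClosed_cthickening
  have hA0 : Disjoint (A \ Metric.thickening δ (P ∪ Q)) B := by
    rw [Set.disjoint_left]
    intro x hx hxB
    exact hx.2 (Metric.self_subset_thickening hδ _ (by rw [hPQ]; exact ⟨hx.1, hxB⟩))
  obtain ⟨δ3, hδ3, hdis3⟩ := hA0.exists_thickenings
    (hA.sdiff Metric.isOpen_thickening).isCompact hB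
  obtain ⟨T, hT, ⟨⟨-, hTc, hTconn, -, -, -⟩, hfin⟩, f, hf, -, hfib⟩ :=
    hX (min δ2 δ3) (lt_min hδ2 hδ3)
  have hdist : ∀ x y, f x = f y → dist x y < min δ2 δ3 := by
    intro x y hxy
    refine lt_of_le_of_lt ?_ (hfib (f y))
    exact Metric.dist_le_diam_of_mem
      ((isClosed_singleton.preimage hf).isCompact.isBounded) (by simpa using hxy) (by simp)
  have hcl : ∀ s : Set X, IsClosed s → IsClosed (f '' s) := fun s hs =>
    (hs.isCompact.image hf).isClosed
  have hpre := hu_of_finite_noncut hfin (hcl A hA) (hAp.image f hf.continuousOn)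
    (hcl B hB) (hBp.image f hf.continuousOn)
  have hclB : IsClosed (f ⁻¹' (f '' B)) := (hcl B hB).preimage hf
  have far : ∀ x y, x ∈ Metric.cthickening δ P → y ∈ Metric.cthickening δ Q → f x ≠ f y := by
    intro x y hx hy hxy
    have := lt_of_lt_of_le (hdist x y hxy) (min_le_left _ _)
    refine (Set.disjoint_left.1 hdis2) (Metric.self_subset_thickening hδ2 _ hx) ?_
    rw [Metric.mem_thickening_iff]
    exact ⟨y, hy, this⟩
  have hcov : f '' A ∩ f '' B ⊆ f '' (A ∩ Metric.cthickening δ P) ∪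
      f '' (A ∩ Metric.cthickening δ Q) := by
    rintro _ ⟨⟨a, ha, rfl⟩, b, hb, hab⟩
    have h1 := lt_of_lt_of_le (hdist a b hab.symm) (min_le_right _ _)
    have h2 : a ∈ Metric.thickening δ (P ∪ Q) := by
      by_contra hcon
      refine (Set.disjoint_left.1 hdis3) (Metric.self_subset_thickening hδ3 _ ⟨ha, hcon⟩) ?_
      rw [Metric.mem_thickening_iff]
      exact ⟨b, hb, h1⟩
    rw [Metric.thickening_union] at h2
    rcases h2 with h2 | h2
    · exact Or.inl ⟨a, ⟨ha, Metric.thickening_subset_cthickening _ _ h2⟩, rfl⟩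
    · exact Or.inr ⟨a, ⟨ha, Metric.thickening_subset_cthickening _ _ h2⟩, rfl⟩
  rcases pre_split hpre (hcl _ (hA.inter Metric.isClosed_cthickening))
    (hcl _ (hA.inter Metric.isClosed_cthickening)) hcov (by
      ext z
      simp only [mem_inter_iff, mem_empty_iff_false, iff_false]
      rintro ⟨-, ⟨x, hx, rfl⟩, y, hy, hxy⟩
      exact far x y hx.2 hy.2 hxy.symm) with h | h
  · obtain ⟨x, hx, hxq⟩ := h ⟨mem_image_of_mem f hqAB.1, mem_image_of_mem f hqAB.2⟩
    exact far x q hx.2 (Metric.self_subset_cthickening _ hq) hxq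
  · obtain ⟨x, hx, hxq⟩ := h ⟨mem_image_of_mem f hpAB.1, mem_image_of_mem f hpAB.2⟩
    exact far p x (Metric.self_subset_cthickening _ hp) hx.2 hxq.symm

/-- closed-set form of hereditary unicoherence -/
def HU (X : Type) [TopologicalSpace X] : Prop :=
  ∀ A B : Set X, IsClosed A → IsPreconnected A → IsClosed B → IsPreconnected B →
    IsPreconnected (A ∩ B)

/-- smallest closed connected set containing `S` -/
def hull {X : Type} [TopologicalSpace X] (S : Set X) : Set X :=
  ⋂₀ {C | IsClosed C ∧ IsPreconnected C ∧ S ⊆ C}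

def seg {X : Type} [TopologicalSpace X] (a b : X) : Set X := hull {a, b}

section
variable {X : Type} [TopologicalSpace X]

theorem hull_closed (S : Set X) : IsClosed (hull S) := isClosed_sInter fun _ h => h.1

theorem subset_hull (S : Set X) : S ⊆ hull S := subset_sInter fun _ h => h.2.2

theorem hull_sub {S C : Set X} (hC : IsClosed C) (hp : IsPreconnected C) (h : S ⊆ C) :
    hull S ⊆ C := sInter_subset_of_mem ⟨hC, hp, h⟩

theorem seg_closed (a b : X) : IsClosed (seg a b) := hull_closed _

theorem left_mem (a b : X) : a ∈ seg a b := subset_hull _ (by simp)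

theorem right_mem (a b : X) : b ∈ seg a b := subset_hull _ (by simp)

theorem seg_comm (a b : X) : seg a b = seg b a := by rw [seg, seg, pair_comm]

theorem seg_sub {a b : X} {C : Set X} (hC : IsClosed C) (hp : IsPreconnected C) (ha : a ∈ C)
    (hb : b ∈ C) : seg a b ⊆ C := hull_sub hC hp (by
      rintro z (rfl | rfl)
      · exact ha
      · exact hb)

variable [T2Space X] [CompactSpace X] [ConnectedSpace X]

theorem hull_pre (h : HU X) (S : Set X) : IsPreconnected (hull S) := by
  refine pre_sInter ⟨univ, isClosed_univ, isPreconnected_univ, subset_univ _⟩ ?_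
    (fun _ h => h.1) (fun _ h => h.2.1)
  intro A hA B hB
  exact ⟨A ∩ B, ⟨hA.1.inter hB.1, h A B hA.1 hA.2.1 hB.1 hB.2.1, subset_inter hA.2.2 hB.2.2⟩,
    inter_subset_left, inter_subset_right⟩

theorem seg_pre (h : HU X) (a b : X) : IsPreconnected (seg a b) := hull_pre h _

theorem seg_union (h : HU X) (a b c : X) : seg a b ⊆ seg a c ∪ seg c b :=
  seg_sub ((seg_closed _ _).union (seg_closed _ _))
    ((seg_pre h a c).union c (right_mem _ _) (left_mem _ _) (seg_pre h c b))
    (Or.inl (left_mem _ _)) (Or.inr (right_mem _ _))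

theorem seg_mono (h : HU X) {a b c d : X} (hc : c ∈ seg a b) (hd : d ∈ seg a b) :
    seg c d ⊆ seg a b := seg_sub (seg_closed _ _) (seg_pre h _ _) hc hd

theorem diff_pre (h : HU X) {a b : X} {H : Set X} (hH : IsClosed H) (hHp : IsPreconnected H)
    (hb : b ∈ H) (ha : a ∉ H) : IsPreconnected (closure (seg a b \ H)) := by
  have key : ∀ u v : Set X, IsClosed u → IsClosed v → u ∪ v = closure (seg a b \ H) → u ∩ v = ∅ →
      v.Nonempty → a ∈ u → False := by
    intro u v hu hv huv hd hvn hau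
    have hpre : IsPreconnected (H ∪ u) := by
      apply pre_left (B := H ∪ v) (hH.union hu) (hH.union hv)
      · have : H ∪ u ∪ (H ∪ v) = seg a b ∪ H := by
          apply Subset.antisymm
          · rintro z ((hz | hz) | (hz | hz))
            · exact Or.inr hz
            · exact Or.inl (closure_minimal sdiff_subset (seg_closed a b) (show z ∈ closure (seg a b \ H) from huv ▸ Or.inl hz))
            · exact Or.inr hz
            · exact Or.inl (closure_minimal sdiff_subset (seg_closed a b) (show z ∈ closure (seg a b \ H) from huv ▸ Or.inr hz))
          · rintro z (hz | hz)
            · by_cases hzH : z ∈ H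
              · exact Or.inl (Or.inl hzH)
              · have : z ∈ u ∪ v := by rw [huv]; exact subset_closure ⟨hz, hzH⟩
                rcases this with h' | h'
                · exact Or.inl (Or.inr h')
                · exact Or.inr (Or.inr h')
            · exact Or.inl (Or.inl hz)
        rw [this]
        exact (seg_pre h a b).union b (right_mem _ _) hb hHp
      · rw [← union_inter_distrib_left, hd, union_empty]; exact hHp
    have hK : seg a b ⊆ H ∪ u := seg_sub (hH.union hu) hpre (Or.inr hau) (Or.inl hb)
    have : closure (seg a b \ H) ⊆ u :=
      closure_minimal (fun z hz => (hK hz.1).resolve_left hz.2) hu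
    obtain ⟨z, hz⟩ := hvn
    have h1 : z ∈ u := this (huv ▸ Or.inr hz)
    have h2 : z ∈ u ∩ v := ⟨h1, hz⟩
    rw [hd] at h2; exact h2
  refine pre_of isClosed_closure fun u v hu hv huv hd hun hvn => ?_
  have haK : a ∈ u ∪ v := by rw [huv]; exact subset_closure ⟨left_mem _ _, ha⟩
  rcases haK with h' | h'
  · exact key u v hu hv huv hd hvn h'
  · exact key v u hv hu (by rw [union_comm]; exact huv) (by rw [inter_comm]; exact hd) hun h'

theorem cut_seg (h : HU X) {a b : X} {H : Set X} (hH : IsClosed H) (hHp : IsPreconnected H)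
    (hb : H.Nonempty → b ∈ H) (ha : a ∉ H) :
    ∃ q, closure (seg a b \ H) = seg a q ∧ (q ∈ H ∨ (H = ∅ ∧ q = b)) ∧
      ∃ G, IsClosed G ∧ IsPreconnected G ∧ q ∈ G ∧ b ∈ G ∧ G ⊆ H ∪ {q} := by
  rcases H.eq_empty_or_nonempty with rfl | hne
  · refine ⟨b, ?_, Or.inr ⟨rfl, rfl⟩, {b}, isClosed_singleton, isPreconnected_singleton, rfl, rfl,
      by simp⟩
    rw [sdiff_empty, (seg_closed a b).closure_eq]
  have hbH := hb hne
  have hSp := diff_pre h hH hHp hbH ha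
  have haS : a ∈ closure (seg a b \ H) := subset_closure ⟨left_mem _ _, ha⟩
  obtain ⟨q, hqK, hqS, hqH⟩ : (seg a b ∩ (closure (seg a b \ H) ∩ H)).Nonempty := by
    refine isPreconnected_closed_iff.1 (seg_pre h a b) _ _ isClosed_closure hH ?_
      ⟨a, left_mem _ _, haS⟩ ⟨b, right_mem _ _, hbH⟩
    intro z hz
    by_cases hzH : z ∈ H
    · exact Or.inr hzH
    · exact Or.inl (subset_closure ⟨hz, hzH⟩)
  refine ⟨q, ?_, Or.inl hqH, H, hH, hHp, hqH, hbH, subset_union_left⟩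
  apply Subset.antisymm
  · refine closure_minimal ?_ (seg_closed _ _)
    have : seg a b ⊆ seg a q ∪ H := seg_sub ((seg_closed _ _).union hH)
      ((seg_pre h a q).union q (right_mem _ _) hqH hHp) (Or.inl (left_mem _ _)) (Or.inr hbH)
    exact fun z hz => (this hz.1).resolve_right hz.2
  · exact seg_sub isClosed_closure hSp haS hqS

/-- every continuum with interior is decomposable -/
def Dec (X : Type) [TopologicalSpace X] : Prop :=
  ∀ C : Set X, IsClosed C → IsPreconnected C → (interior C).Nonempty →
    ∃ H K : Set X, IsClosed H ∧ IsPreconnected H ∧ IsClosed K ∧ IsPreconnected K ∧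
      H ∪ K = C ∧ H ≠ C ∧ K ≠ C

theorem seg_inter (h : HU X) (hD : Dec X) {a b c : X} (hc : c ∈ seg a b) :
    interior (seg a c ∩ seg c b) = ∅ := by
  by_contra hne
  rw [← ne_eq, ← nonempty_iff_ne_empty] at hne
  set O := interior (seg a c ∩ seg c b) with hO
  have hOo : IsOpen O := isOpen_interior
  have hOP : O ⊆ seg a c := interior_subset.trans inter_subset_left
  have hOR : O ⊆ seg c b := interior_subset.trans inter_subset_right
  have hPK : seg a c ⊆ seg a b := seg_mono h (left_mem _ _) hc
  have hRK : seg c b ⊆ seg a b := seg_mono h hc (right_mem _ _)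
  have hK := seg_union h a b c
  -- the two ends
  have hdO : ∀ S : Set X, O ⊆ S → ∀ z, z ∈ closure (seg a b \ S) → z ∈ O → False := by
    intro S hS z hz hzO
    obtain ⟨w, hw, hw'⟩ := mem_closure_iff.1 hz O hOo hzO
    exact hw'.2 (hS hw)
  obtain ⟨P', hP'⟩ : ∃ P', P' = closure (seg a b \ seg c b) := ⟨_, rfl⟩
  obtain ⟨R', hR'⟩ : ∃ R', R' = closure (seg a b \ seg a c) := ⟨_, rfl⟩
  have hP'O : ∀ z, z ∈ P' → z ∈ O → False := by rw [hP']; exact hdO _ hOR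
  have hR'O : ∀ z, z ∈ R' → z ∈ O → False := by rw [hR']; exact hdO _ hOP
  have hP'c : IsClosed P' := by rw [hP']; exact isClosed_closure
  have hR'c : IsClosed R' := by rw [hR']; exact isClosed_closure
  have hP'1 : IsPreconnected P' ∧ (P'.Nonempty → a ∈ P') := by
    by_cases haR : a ∈ seg c b
    · have : seg a b ⊆ seg c b := seg_mono h haR (right_mem _ _)
      rw [sdiff_eq_empty.2 this, closure_empty] at hP'
      rw [hP']; exact ⟨isPreconnected_empty, by simp⟩
    · rw [hP']
      exact ⟨diff_pre h (seg_closed _ _) (seg_pre h _ _) (right_mem _ _) haR,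
        fun _ => subset_closure ⟨left_mem _ _, haR⟩⟩
  have hR'1 : IsPreconnected R' ∧ (R'.Nonempty → b ∈ R') := by
    by_cases hbP : b ∈ seg a c
    · have : seg a b ⊆ seg a c := seg_mono h (left_mem _ _) hbP
      rw [sdiff_eq_empty.2 this, closure_empty] at hR'
      rw [hR']; exact ⟨isPreconnected_empty, by simp⟩
    · rw [hR', seg_comm a b]
      exact ⟨diff_pre h (seg_closed _ _) (seg_pre h _ _) (left_mem _ _) hbP,
        fun _ => subset_closure ⟨left_mem _ _, hbP⟩⟩
  obtain ⟨o, ho⟩ := hne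
  have hoK : o ∈ seg a b := hPK (hOP ho)
  have hdisj : ∀ z, z ∈ P' → z ∈ R' → False := by
    intro z h1 h2
    have : seg a b ⊆ P' ∪ R' := seg_sub (hP'c.union hR'c) (hP'1.1.union z h1 h2 hR'1.1)
      (Or.inl (hP'1.2 ⟨z, h1⟩)) (Or.inr (hR'1.2 ⟨z, h2⟩))
    rcases this hoK with h' | h'
    · exact hP'O o h' ho
    · exact hR'O o h' ho
  have hbP' : b ∉ P' := fun hb =>
    hP'O o (seg_sub hP'c hP'1.1 (hP'1.2 ⟨b, hb⟩) hb hoK) ho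
  have haR' : a ∉ R' := fun ha =>
    hR'O o (seg_sub hR'c hR'1.1 ha (hR'1.2 ⟨a, ha⟩) hoK) ho
  have hcP' : c ∉ P' := fun hc' =>
    hP'O o (seg_sub hP'c hP'1.1 (hP'1.2 ⟨c, hc'⟩) hc' (hOP ho)) ho
  have hcR' : c ∉ R' := fun hc' =>
    hR'O o (seg_sub hR'c hR'1.1 hc' (hR'1.2 ⟨c, hc'⟩) (hOR ho)) ho
  obtain ⟨p, hSp, hpP, G, hGc, hGp, hpG, haG, hGP⟩ := cut_seg h (a := b) (b := a) hP'c hP'1.1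
    hP'1.2 hbP'
  have hpR' : p ∉ R' := by
    rcases hpP with h' | ⟨-, rfl⟩
    · exact fun h2 => hdisj p h' h2
    · exact haR'
  obtain ⟨r, hEr, hrR, G2, hG2c, hG2p, hrG2, hbG2, hG2R⟩ := cut_seg h (a := p) (b := b) hR'c hR'1.1
    hR'1.2 hpR'
  rw [seg_comm b a, seg_comm b p] at hSp
  have hE : seg p r ⊆ closure ((seg a b \ P') \ R') := by
    rw [← hEr, ← hSp]
    refine closure_minimal ?_ isClosed_closure
    intro z hz
    rw [mem_closure_iff]
    intro o ho hzo
    obtain ⟨w, hw1, hw2⟩ := mem_closure_iff.1 hz.1 (o ∩ R'ᶜ) (ho.inter hR'c.isOpen_compl) ⟨hzo, hz.2⟩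
    exact ⟨w, hw1.1, hw2, hw1.2⟩
  have hE2 : (seg a b \ P') \ R' ⊆ seg p r := by
    rw [← hEr, ← hSp]
    exact fun z hz => subset_closure ⟨subset_closure hz.1, hz.2⟩
  have hcE : c ∈ seg p r := hE2 ⟨⟨hc, hcP'⟩, hcR'⟩
  have hpc : seg p r ⊆ seg p c := by
    refine hE.trans (closure_minimal ?_ (seg_closed _ _))
    rintro z ⟨⟨hzK, hzP⟩, hzR⟩
    have hzPc : z ∈ seg a c := by
      by_contra h'
      exact hzR (hR' ▸ subset_closure ⟨hzK, h'⟩)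
    have : seg a c ⊆ G ∪ seg p c := seg_sub (hGc.union (seg_closed _ _))
      (hGp.union p hpG (left_mem _ _) (seg_pre h _ _)) (Or.inl haG) (Or.inr (right_mem _ _))
    rcases this hzPc with h' | h'
    · rcases hGP h' with h'' | h''
      · exact absurd h'' hzP
      · rw [mem_singleton_iff.1 h'']; exact left_mem _ _
    · exact h'
  have hrc : seg p r ⊆ seg r c := by
    refine hE.trans (closure_minimal ?_ (seg_closed _ _))
    rintro z ⟨⟨hzK, hzP⟩, hzR⟩
    have hzPc : z ∈ seg c b := by
      by_contra h'
      exact hzP (hP' ▸ subset_closure ⟨hzK, h'⟩)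
    have : seg c b ⊆ G2 ∪ seg r c := seg_sub (hG2c.union (seg_closed _ _))
      (hG2p.union r hrG2 (left_mem _ _) (seg_pre h _ _)) (Or.inr (right_mem _ _)) (Or.inl hbG2)
    rcases this hzPc with h' | h'
    · rcases hG2R h' with h'' | h''
      · exact absurd h'' hzR
      · rw [mem_singleton_iff.1 h'']; exact left_mem _ _
    · exact h'
  obtain ⟨H, K, hHc, hHp, hKc, hKp, hHK, hHne, hKne⟩ := hD (seg p r) (seg_closed _ _)
    (seg_pre h _ _) ⟨o, (interior_maximal (fun z hz => hE2 ⟨⟨hPK (hOP hz), fun h' => hP'O z h' hz⟩,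
      fun h' => hR'O z h' hz⟩) hOo) ho⟩
  have hall : ∀ L : Set X, IsClosed L → IsPreconnected L → L ⊆ seg p r → L ≠ seg p r →
      ¬ (p ∈ L ∧ r ∈ L) ∧ ¬ (p ∈ L ∧ c ∈ L) ∧ ¬ (r ∈ L ∧ c ∈ L) := by
    intro L hL hLp hsub hne
    refine ⟨fun h' => hne (hsub.antisymm (seg_sub hL hLp h'.1 h'.2)),
      fun h' => hne (hsub.antisymm (hpc.trans (seg_sub hL hLp h'.1 h'.2))),
      fun h' => hne (hsub.antisymm (hrc.trans (seg_sub hL hLp h'.1 h'.2)))⟩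
  have h1 := hall H hHc hHp (hHK ▸ subset_union_left) hHne
  have h2 := hall K hKc hKp (hHK ▸ subset_union_right) hKne
  have e1 : p ∈ H ∪ K := hHK ▸ left_mem p r
  have e2 : r ∈ H ∪ K := hHK ▸ right_mem p r
  have e3 : c ∈ H ∪ K := hHK ▸ hcE
  simp only [mem_union] at e1 e2 e3
  clear * - h1 h2 e1 e2 e3
  tauto

end

end MC

namespace MC

section
variable {X : Type} [TopologicalSpace X]

/-- `a` and `b` lie in a common nowhere dense continuum -/
def R (a b : X) : Prop := interior (seg a b) = ∅

theorem R.symm {a b : X} (h : R a b) : R b a := by rw [R, seg_comm]; exact h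

theorem R_of_sub {a b : X} {C : Set X} (h : seg a b ⊆ C) (hC : interior C = ∅) : R a b :=
  subset_empty_iff.1 (hC ▸ interior_mono h)

variable [T2Space X] [CompactSpace X] [ConnectedSpace X]

theorem R.trans (h : HU X) {a b c : X} (h1 : R a b) (h2 : R b c) : R a c := by
  refine R_of_sub (seg_union h a c b) ?_
  rw [interior_union_isClosed_of_interior_empty (seg_closed _ _) h2]; exact h1

theorem R.mono (h : HU X) {a b c d : X} (h1 : R a b) (hc : c ∈ seg a b) (hd : d ∈ seg a b) :
    R c d := R_of_sub (seg_mono h hc hd) h1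

theorem seg_self (a : X) : seg a a = {a} :=
  (seg_sub isClosed_singleton isPreconnected_singleton rfl rfl).antisymm
    (singleton_subset_iff.2 (left_mem a a))

theorem mid_aux (h : HU X) (hD : Dec X) (hr : ∀ x : X, R x x) {a b : X} (hab : ¬ R a b)
    (hcov : ∀ x ∈ seg a b, R a x ∨ R b x) (hcl : b ∈ closure {x ∈ seg a b | R a x}) : False := by
  set W := interior (seg a b) with hW
  have hWo : IsOpen W := isOpen_interior
  have hWne : W.Nonempty := nonempty_iff_ne_empty.2 hab
  have hWK : W ⊆ seg a b := interior_subset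
  obtain ⟨J, hJ⟩ : ∃ J, J = hull (W ∪ {b}) := ⟨_, rfl⟩
  have hJc : IsClosed J := hJ ▸ hull_closed _
  have hJp : IsPreconnected J := hJ ▸ hull_pre h _
  have hWJ : W ⊆ J := fun z hz => hJ ▸ subset_hull _ (Or.inl hz)
  have hbJ : b ∈ J := hJ ▸ subset_hull _ (Or.inr rfl)
  have hJmin : ∀ C : Set X, IsClosed C → IsPreconnected C → W ⊆ C → b ∈ C → J ⊆ C := by
    intro C hC hCp h1 h2
    rw [hJ]
    exact hull_sub hC hCp (union_subset h1 (singleton_subset_iff.2 h2))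
  have hJK : J ⊆ seg a b := hJmin _ (seg_closed _ _) (seg_pre h _ _) hWK (right_mem _ _)
  obtain ⟨a', ha'J, haa', hKJ, hWa⟩ : ∃ a' ∈ J, R a a' ∧ seg a b \ J ⊆ seg a a' ∧
      W ∩ seg a a' ⊆ {a'} := by
    by_cases ha : a ∈ J
    · refine ⟨a, ha, hr a, ?_, ?_⟩
      · intro z hz
        exact absurd (seg_sub hJc hJp ha hbJ hz.1) hz.2
      · rw [seg_self]; exact inter_subset_right
    · obtain ⟨a', hS, ha', -⟩ := cut_seg h (a := a) (b := b) hJc hJp (fun _ => hbJ) ha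
      have hemp : ∀ z, z ∈ W → z ∈ seg a a' → False := by
        intro z hz hz'
        rw [← hS] at hz'
        obtain ⟨w, hw, hw'⟩ := mem_closure_iff.1 hz' W hWo hz
        exact hw'.2 (hWJ hw)
      have ha'J : a' ∈ J := by
        rcases ha' with h' | ⟨h', -⟩
        · exact h'
        · rw [h'] at hbJ; exact absurd hbJ (by simp)
      refine ⟨a', ha'J, ?_, hS ▸ subset_closure, fun z hz => (hemp z hz.1 hz.2).elim⟩
      rw [R, eq_empty_iff_forall_notMem]
      intro z hz
      exact hemp z (interior_mono (seg_mono h (left_mem _ _) (hJK ha'J)) hz) (interior_subset hz)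
  have hJs : J = seg a' b := by
    apply Subset.antisymm
    · refine hJmin _ (seg_closed _ _) (seg_pre h _ _) ?_ (right_mem _ _)
      intro z hz
      rcases seg_union h a b a' (hWK hz) with h' | h'
      · rw [mem_singleton_iff.1 (hWa ⟨hz, h'⟩)]; exact left_mem _ _
      · exact h'
    · exact seg_sub hJc hJp ha'J hbJ
  have main : ∀ P Q : Set X, IsClosed P → IsPreconnected P → IsClosed Q → IsPreconnected Q →
      P ∪ Q = J → P ≠ J → Q ≠ J → b ∈ Q → False := by
    intro P Q hPc hPp hQc hQp hPQ hPne hQne hbQ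
    have hPJ : P ⊆ J := hPQ ▸ subset_union_left
    have hQJ : Q ⊆ J := hPQ ▸ subset_union_right
    have ha'Q : a' ∉ Q := fun h' => hQne (hQJ.antisymm (hJs ▸ seg_sub hQc hQp h' hbQ))
    have ha'P : a' ∈ P := by
      have : a' ∈ P ∪ Q := hPQ ▸ ha'J
      exact this.resolve_right ha'Q
    have hbP : b ∉ P := fun h' => hPne (hPJ.antisymm (hJs ▸ seg_sub hPc hPp ha'P h'))
    obtain ⟨d, hS, hd, -⟩ := cut_seg h (a := a') (b := b) hQc hQp (fun _ => hbQ) ha'Q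
    have hdQ : d ∈ Q := by
      rcases hd with h' | ⟨h', -⟩
      · exact h'
      · rw [h'] at hbQ; exact absurd hbQ (by simp)
    rw [← hJs] at hS
    have hP1 : seg a' d ⊆ P := by
      rw [← hS]
      refine closure_minimal (fun z hz => ?_) hPc
      have : z ∈ P ∪ Q := hPQ ▸ hz.1
      exact this.resolve_right hz.2
    rcases hcov d (hJK (hQJ hdQ)) with hRd | hRd
    · have h1 : R a' d := haa'.symm.trans h hRd
      have hWQ : W ⊆ Q := by
        intro z hz
        by_contra hzQ
        have : z ∈ interior (seg a' d) := by
          refine interior_maximal (s := seg a' d) (t := W ∩ Qᶜ) ?_ (hWo.inter hQc.isOpen_compl)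
            ⟨hz, hzQ⟩
          rintro w ⟨hw, hw'⟩
          rw [← hS]
          exact subset_closure ⟨hWJ hw, hw'⟩
        rw [h1] at this; exact this
      exact hQne (hQJ.antisymm (hJmin _ hQc hQp hWQ hbQ))
    · have hsub : closure {x ∈ seg a b | R a x} ⊆ seg a a' ∪ seg a' d := by
        refine closure_minimal ?_ ((seg_closed _ _).union (seg_closed _ _))
        rintro x ⟨hxK, hax⟩
        by_cases hxJ : x ∈ J
        · rw [hJs] at hxJ
          rcases seg_union h a' b d hxJ with h' | h'
          · exact Or.inr h'
          · exact absurd (hax.trans h (hRd.symm.mono h h' (right_mem _ _))) hab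
        · exact Or.inl (hKJ ⟨hxK, hxJ⟩)
      rcases hsub hcl with h' | h'
      · exact hab (haa'.mono h (left_mem _ _) h')
      · exact hbP (hP1 h')
  obtain ⟨P, Q, hPc, hPp, hQc, hQp, hPQ, hPne, hQne⟩ := hD J hJc hJp
    (hWne.mono (interior_maximal hWJ hWo))
  have hb : b ∈ P ∪ Q := hPQ ▸ hbJ
  rcases hb with hb | hb
  · exact main Q P hQc hQp hPc hPp (by rw [union_comm]; exact hPQ) hQne hPne hb
  · exact main P Q hPc hPp hQc hQp hPQ hPne hQne hb

theorem mid_closed (h : HU X) (hD : Dec X) (hr : ∀ x : X, R x x) {a b : X} (hab : ¬ R a b)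
    (hcov : ∀ x ∈ seg a b, R a x ∨ R b x) : IsClosed {x ∈ seg a b | R a x} := by
  refine isClosed_of_closure_subset fun c hc => ?_
  have hcK : c ∈ seg a b := closure_minimal (fun z hz => hz.1) (seg_closed _ _) hc
  by_contra hcon
  have hac : ¬ R a c := fun h' => hcon ⟨hcK, h'⟩
  have hbc : R b c := (hcov c hcK).resolve_left hac
  refine mid_aux h hD hr hac (fun x hx => ?_) ?_
  · exact (hcov x (seg_mono h (left_mem _ _) hcK hx)).imp id fun h' => hbc.symm.trans h h'
  · refine closure_mono ?_ hc
    rintro x ⟨hxK, hax⟩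
    refine ⟨?_, hax⟩
    rcases seg_union h a b c hxK with h' | h'
    · exact h'
    · exact absurd (hax.trans h (hbc.symm.mono h h' (right_mem _ _))) hab

theorem mid (h : HU X) (hD : Dec X) (hr : ∀ x : X, R x x) {a b : X} (hab : ¬ R a b) :
    ∃ c ∈ seg a b, ¬ R a c ∧ ¬ R c b := by
  by_contra hcon
  push Not at hcon
  have hcov : ∀ x ∈ seg a b, R a x ∨ R b x := by
    intro x hx
    by_cases h' : R a x
    · exact Or.inl h'
    · exact Or.inr (hcon x hx h').symm
  have h1 := mid_closed h hD hr hab hcov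
  have h2 := mid_closed h hD hr (a := b) (b := a) (fun h' => hab h'.symm)
    (fun x hx => (hcov x (seg_comm b a ▸ hx)).symm)
  rcases pre_split (seg_pre h a b) h1 h2 (fun x hx => (hcov x hx).imp (fun h' => ⟨hx, h'⟩)
    (fun h' => ⟨seg_comm a b ▸ hx, h'⟩)) (by
      ext z
      simp only [mem_inter_iff, mem_empty_iff_false, iff_false, mem_setOf_eq]
      rintro ⟨-, h3, h4⟩
      exact hab (h3.2.trans h h4.2.symm)) with h' | h'
  · exact hab (h' (right_mem _ _)).2
  · exact hab (h' (left_mem _ _)).2.symm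

theorem split (h : HU X) (hD : Dec X) (hr : ∀ x : X, R x x) {a b : X} (hab : ¬ R a b) :
    ∃ c d, ¬ R a c ∧ ¬ R d b ∧ seg a c ⊆ seg a b ∧ seg d b ⊆ seg a b ∧
      ∀ x ∈ seg a c, ∀ y ∈ seg d b, ¬ R x y := by
  obtain ⟨c, hc, hac, hcb⟩ := mid h hD hr hab
  obtain ⟨d, hd, hcd, hdb⟩ := mid h hD hr hcb
  have hcbK := seg_mono h hc (right_mem a b)
  refine ⟨c, d, hac, hdb, seg_mono h (left_mem _ _) hc, seg_mono h (hcbK hd) (right_mem _ _), ?_⟩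
  intro x hx y hy hxy
  apply hcd
  have e1 := seg_inter h hD hc
  have e2 := seg_inter h hD hd
  refine R_of_sub (C := (seg a c ∩ seg c b) ∪ (seg x y ∪ (seg c d ∩ seg d b))) ?_ ?_
  · intro z hz
    rcases seg_union h c d x hz with h' | h'
    · exact Or.inl ⟨seg_mono h (right_mem _ _) hx h', seg_mono h (left_mem _ _) hd hz⟩
    · rcases seg_union h x d y h' with h' | h'
      · exact Or.inr (Or.inl h')
      · exact Or.inr (Or.inr ⟨hz, seg_mono h hy (left_mem _ _) h'⟩)
  · rw [interior_union_isClosed_of_interior_empty ((seg_closed _ _).inter (seg_closed _ _))]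
    · exact e1
    · rw [interior_union_isClosed_of_interior_empty (seg_closed _ _) e2]
      exact hxy

theorem case2 (h : HU X) (hD : Dec X) (hr : ∀ x : X, R x x) {a b : X} (hab : ¬ R a b) :
    ∃ f : (ℕ → Bool) → X, ∀ s t, s ≠ t → ¬ R (f s) (f t) := by
  have hstep : ∀ i : {p : X × X // ¬ R p.1 p.2}, ∃ j k : {p : X × X // ¬ R p.1 p.2},
      seg j.1.1 j.1.2 ⊆ seg i.1.1 i.1.2 ∧ seg k.1.1 k.1.2 ⊆ seg i.1.1 i.1.2 ∧
      ∀ x ∈ seg j.1.1 j.1.2, ∀ y ∈ seg k.1.1 k.1.2, ¬ R x y := by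
    rintro ⟨⟨a, b⟩, hab⟩
    obtain ⟨c, d, h1, h2, h3, h4, h5⟩ := split h hD hr hab
    exact ⟨⟨⟨a, c⟩, h1⟩, ⟨⟨d, b⟩, h2⟩, h3, h4, h5⟩
  choose j k hj hk hjk using hstep
  let node : (ℕ → Bool) → ℕ → {p : X × X // ¬ R p.1 p.2} := fun s n =>
    Nat.rec ⟨(a, b), hab⟩ (fun n i => if s n then j i else k i) n
  have hnode : ∀ s n, node s (n + 1) = if s n then j (node s n) else k (node s n) :=
    fun s n => rfl
  have hex : ∀ s, (⋂ n, seg (node s n).1.1 (node s n).1.2).Nonempty := by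
    intro s
    refine IsCompact.nonempty_iInter_of_sequence_nonempty_isCompact_isClosed _ ?_ ?_ ?_ ?_
    · intro n
      rw [hnode]
      split_ifs
      · exact hj _
      · exact hk _
    · exact fun n => ⟨_, left_mem _ _⟩
    · exact (seg_closed _ _).isCompact
    · exact fun n => seg_closed _ _
  choose f hf using hex
  refine ⟨f, ?_⟩
  have key : ∀ s t : ℕ → Bool, ∀ n, (∀ m < n, s m = t m) → s n = true → t n = false →
      ¬ R (f s) (f t) := by
    intro s t n hlt hs ht
    have hag : ∀ m ≤ n, node s m = node t m := by
      intro m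
      induction m with
      | zero => intro _; rfl
      | succ m ih =>
        intro hm
        rw [hnode, hnode, ih (by omega), hlt m (by omega)]
    have h1 := mem_iInter.1 (hf s) (n + 1)
    have h2 := mem_iInter.1 (hf t) (n + 1)
    rw [hnode, hs, hag n le_rfl] at h1
    rw [hnode, ht] at h2
    exact hjk _ _ h1 _ h2
  intro s t hst
  have hex : ∃ n, s n ≠ t n := Function.ne_iff.1 hst
  classical
  have hn := Nat.find_spec hex
  have hlt : ∀ m < Nat.find hex, s m = t m := fun m hm => not_not.1 (Nat.find_min hex hm)
  cases hs : s (Nat.find hex) with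
  | true => exact key s t _ hlt hs (by rw [hs] at hn; simpa using hn.symm)
  | false =>
    intro hR
    exact key t s _ (fun m hm => (hlt m hm).symm) (by rw [hs] at hn; simpa using hn.symm) hs hR.symm

end

section
variable {Y : Type} [TopologicalSpace Y] [T2Space Y] [CompactSpace Y] [PreconnectedSpace Y]

def Indec (Y : Type) [TopologicalSpace Y] : Prop :=
  ∀ H K : Set Y, IsClosed H → IsPreconnected H → IsClosed K → IsPreconnected K →
    H ∪ K = univ → H = univ ∨ K = univ

theorem indec_interior (hI : Indec Y) {C : Set Y} (hC : IsClosed C) (hCp : IsPreconnected C)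
    (hne : C ≠ univ) : interior C = ∅ := by
  by_contra hCi
  rw [← ne_eq, ← nonempty_iff_ne_empty] at hCi
  obtain ⟨o, ho⟩ := hCi
  have hcov : C ∪ closure Cᶜ = univ := by
    rw [eq_univ_iff_forall]
    intro z
    by_cases hz : z ∈ C
    · exact Or.inl hz
    · exact Or.inr (subset_closure hz)
  have hSne : closure Cᶜ ≠ univ := by
    intro h'
    have : o ∈ closure Cᶜ := h' ▸ mem_univ o
    rw [closure_compl] at this
    exact this ho
  have hpre : IsPreconnected (closure Cᶜ) := by
    refine pre_of isClosed_closure fun u v hu hv huv hd hun hvn => ?_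
    have huniv : (C ∪ u) ∪ (C ∪ v) = univ := by
      rw [← union_union_distrib_left, huv, hcov]
    have hi : (C ∪ u) ∩ (C ∪ v) = C := by rw [← union_inter_distrib_left, hd, union_empty]
    have key : ∀ u v : Set Y, IsClosed u → u ∪ v = closure Cᶜ → u ∩ v = ∅ → v.Nonempty →
        C ∪ u = univ → False := by
      intro u v hu huv hd ⟨z, hz⟩ h'
      have h1 : closure Cᶜ ⊆ u := closure_minimal (fun z hz => by
        have : z ∈ C ∪ u := h' ▸ mem_univ z
        exact this.resolve_left hz) hu
      have : z ∈ u ∩ v := ⟨h1 (huv ▸ Or.inr hz), hz⟩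
      rw [hd] at this; exact this
    have p1 : IsPreconnected (C ∪ u) := pre_left (B := C ∪ v) (hC.union hu) (hC.union hv)
      (by rw [huniv]; exact isPreconnected_univ) (by rw [hi]; exact hCp)
    have p2 : IsPreconnected (C ∪ v) := pre_left (B := C ∪ u) (hC.union hv) (hC.union hu)
      (by rw [union_comm, huniv]; exact isPreconnected_univ) (by rw [inter_comm, hi]; exact hCp)
    rcases hI _ _ (hC.union hu) p1 (hC.union hv) p2 huniv with h' | h'
    · exact key u v hu huv hd hvn h'
    · exact key v u hv (by rw [union_comm]; exact huv) (by rw [inter_comm]; exact hd) hun h'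
  rcases hI _ _ hC hCp isClosed_closure hpre hcov with h' | h'
  · exact hne h'
  · exact hSne h'

def Good (B D E : Set Y) : Prop :=
  ∀ L : Set Y, IsClosed L → IsPreconnected L → L ∩ B = ∅ → (L ∩ D).Nonempty →
    (L ∩ E).Nonempty → False

theorem two (hI : Indec Y) {B D E : Set Y} (hB : IsOpen B) (hBn : B.Nonempty) (hD : IsOpen D)
    (hDn : D.Nonempty) (hE : IsOpen E) (hEn : E.Nonempty) :
    ∃ D' E', D' ⊆ D ∧ E' ⊆ E ∧ IsOpen D' ∧ IsOpen E' ∧ D'.Nonempty ∧ E'.Nonempty ∧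
      Good B D' E' := by
  have hgB : ∀ L : Set Y, L ∩ B = ∅ → ∀ z, z ∈ L → z ∈ B → False := by
    intro L hL z h1 h2
    have : z ∈ L ∩ B := ⟨h1, h2⟩
    rw [hL] at this; exact this
  obtain ⟨x, hx⟩ := hDn
  by_cases hxB : x ∈ B
  · refine ⟨D ∩ B, E, inter_subset_left, subset_rfl, hD.inter hB, hE, ⟨x, hx, hxB⟩, hEn, ?_⟩
    rintro L - - hLB ⟨z, hz⟩ -
    exact hgB L hLB z hz.1 hz.2.2
  have hF : IsClosed Bᶜ := hB.isClosed_compl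
  have : CompactSpace (Bᶜ : Set Y) := isCompact_iff_compactSpace.1 hF.isCompact
  obtain ⟨C, hC⟩ : ∃ C : Set Y, C = Subtype.val '' connectedComponent (⟨x, hxB⟩ : (Bᶜ : Set Y)) :=
    ⟨_, rfl⟩
  have hCB : C ⊆ Bᶜ := by rw [hC]; rintro _ ⟨z, -, rfl⟩; exact z.2
  have hCc : IsClosed C := by
    rw [hC]; exact hF.isClosedEmbedding_subtypeVal.isClosedMap _ isClosed_connectedComponent
  have hCp : IsPreconnected C := by
    rw [hC]; exact isPreconnected_connectedComponent.image _ continuous_subtype_val.continuousOn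
  have hCne : C ≠ univ := by
    rintro h'
    obtain ⟨z, hz⟩ := hBn
    exact hCB (h' ▸ mem_univ z) hz
  have hCi := indec_interior hI hCc hCp hCne
  obtain ⟨y, hyE, hyC⟩ : ∃ y ∈ E, y ∉ C := by
    by_contra hcon
    push Not at hcon
    have : E ⊆ interior C := interior_maximal hcon hE
    rw [hCi] at this
    obtain ⟨z, hz⟩ := hEn
    exact this hz
  by_cases hyB : y ∈ B
  · refine ⟨D, E ∩ B, subset_rfl, inter_subset_left, hD, hE.inter hB, ⟨x, hx⟩, ⟨y, hyE, hyB⟩, ?_⟩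
    rintro L - - hLB - ⟨z, hz⟩
    exact hgB L hLB z hz.1 hz.2.2
  have hyc : (⟨y, hyB⟩ : (Bᶜ : Set Y)) ∉ connectedComponent (⟨x, hxB⟩ : (Bᶜ : Set Y)) := by
    intro h'
    exact hyC (hC ▸ ⟨_, h', rfl⟩)
  rw [connectedComponent_eq_iInter_isClopen] at hyc
  simp only [mem_iInter, not_forall] at hyc
  obtain ⟨⟨Z, hZ, hxZ⟩, hyZ⟩ := hyc
  have hF1 : IsClosed (Subtype.val '' Z) := hF.isClosedEmbedding_subtypeVal.isClosedMap _ hZ.1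
  have hF2 : IsClosed (Subtype.val '' Zᶜ) :=
    hF.isClosedEmbedding_subtypeVal.isClosedMap _ hZ.2.isClosed_compl
  have hdis : ∀ z, z ∈ Subtype.val '' Z → z ∈ Subtype.val '' Zᶜ → False := by
    rintro _ ⟨z, hz, rfl⟩ ⟨w, hw, hwz⟩
    rw [Subtype.ext hwz] at hw
    exact hw hz
  refine ⟨D \ (Subtype.val '' Zᶜ), E \ (Subtype.val '' Z), sdiff_subset, sdiff_subset,
    hD.sdiff hF2, hE.sdiff hF1, ⟨x, hx, fun h' => hdis x ⟨_, hxZ, rfl⟩ h'⟩,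
    ⟨y, hyE, fun h' => hdis y h' ⟨_, hyZ, rfl⟩⟩, ?_⟩
  rintro L hL hLp hLB ⟨d, hdL, hdD⟩ ⟨e, heL, heE⟩
  rcases pre_split hLp hF1 hF2 (fun z hz => by
      have hzB : z ∉ B := hgB L hLB z hz
      by_cases hzZ : (⟨z, hzB⟩ : (Bᶜ : Set Y)) ∈ Z
      · exact Or.inl ⟨_, hzZ, rfl⟩
      · exact Or.inr ⟨_, hzZ, rfl⟩) (by
      ext z
      simp only [mem_inter_iff, mem_empty_iff_false, iff_false]
      exact fun h' => hdis z h'.2.1 h'.2.2) with h' | h'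
  · exact heE.2 (h' heL)
  · exact hdD.2 (h' hdL)

theorem many (hI : Indec Y) {B : Set Y} (hB : IsOpen B) (hBn : B.Nonempty) {ι : Type}
    (D : ι → Set Y) (hD : ∀ i, IsOpen (D i)) (hDn : ∀ i, (D i).Nonempty) (S : Finset (ι × ι)) :
    ∃ D' : ι → Set Y, (∀ i, D' i ⊆ D i) ∧ (∀ i, IsOpen (D' i)) ∧ (∀ i, (D' i).Nonempty) ∧
      ∀ p ∈ S, p.1 ≠ p.2 → Good B (D' p.1) (D' p.2) := by
  classical
  induction S using Finset.induction_on with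
  | empty => exact ⟨D, fun _ => subset_rfl, hD, hDn, by simp⟩
  | insert q S hq ih =>
    obtain ⟨D', h1, h2, h3, h4⟩ := ih
    by_cases hne : q.1 = q.2
    · refine ⟨D', h1, h2, h3, fun p hp hpn => ?_⟩
      rcases Finset.mem_insert.1 hp with rfl | hp
      · exact absurd hne hpn
      · exact h4 p hp hpn
    obtain ⟨U, V, hU, hV, hUo, hVo, hUn, hVn, hg⟩ := two hI hB hBn (h2 q.1) (h3 q.1) (h2 q.2) (h3 q.2)
    obtain ⟨F, hF⟩ : ∃ F : ι → Set Y, F = fun k => if k = q.1 then U else if k = q.2 then V else D' k :=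
      ⟨_, rfl⟩
    have hF1 : F q.1 = U := by simp [hF]
    have hF2 : F q.2 = V := by simp [hF, Ne.symm hne]
    have hFsub : ∀ k, F k ⊆ D' k := by
      intro k
      rw [hF]; dsimp only
      split_ifs with e1 e2
      · rw [e1]; exact hU
      · rw [e2]; exact hV
      · exact subset_rfl
    refine ⟨F, fun k => (hFsub k).trans (h1 k), ?_, ?_, ?_⟩
    · intro k
      rw [hF]; dsimp only
      split_ifs
      exacts [hUo, hVo, h2 k]
    · intro k
      rw [hF]; dsimp only
      split_ifs
      exacts [hUn, hVn, h3 k]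
    · intro p hp hpn
      rcases Finset.mem_insert.1 hp with rfl | hp
      · rw [hF1, hF2]; exact hg
      · intro L hL hLp hLB e1 e2
        exact h4 p hp hpn L hL hLp hLB (e1.mono (inter_subset_inter_right _ (hFsub _)))
          (e2.mono (inter_subset_inter_right _ (hFsub _)))

theorem step (hI : Indec Y) {B : Set Y} (hB : IsOpen B) (hBn : B.Nonempty) {ι : Type} [Finite ι]
    (D : ι → Set Y) (hD : ∀ i, IsOpen (D i)) (hDn : ∀ i, (D i).Nonempty) :
    ∃ D' : ι → Set Y, (∀ i, closure (D' i) ⊆ D i) ∧ (∀ i, IsOpen (D' i)) ∧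
      (∀ i, (D' i).Nonempty) ∧ ∀ i j, i ≠ j → Good B (closure (D' i)) (closure (D' j)) := by
  have := Fintype.ofFinite ι
  obtain ⟨E, h1, h2, h3, h4⟩ := many hI hB hBn D hD hDn Finset.univ
  have : ∀ i, ∃ U : Set Y, IsOpen U ∧ U.Nonempty ∧ closure U ⊆ E i := by
    intro i
    obtain ⟨x, hx⟩ := h3 i
    obtain ⟨t, ht, htc, hts⟩ := exists_mem_nhds_isClosed_subset ((h2 i).mem_nhds hx)
    exact ⟨interior t, isOpen_interior, ⟨x, mem_interior_iff_mem_nhds.2 ht⟩,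
      (closure_minimal interior_subset htc).trans hts⟩
  choose U hU hUn hUs using this
  refine ⟨U, fun i => (hUs i).trans (h1 i), hU, hUn, fun i j hij L hL hLp hLB e1 e2 => ?_⟩
  exact h4 (i, j) (Finset.mem_univ _) hij L hL hLp hLB (e1.mono (inter_subset_inter_right _ (hUs i)))
    (e2.mono (inter_subset_inter_right _ (hUs j)))

theorem case1 [SecondCountableTopology Y] [Nonempty Y] (hI : Indec Y) :
    ∃ f : (ℕ → Bool) → Y, ∀ s t, s ≠ t → ∀ L : Set Y, IsClosed L → IsPreconnected L →
      f s ∈ L → f t ∈ L → L = univ := by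
  have hbc := TopologicalSpace.countable_countableBasis Y
  have hbb := TopologicalSpace.isBasis_countableBasis Y
  have hbne : (TopologicalSpace.countableBasis Y).Nonempty := by
    obtain ⟨y⟩ := ‹Nonempty Y›
    obtain ⟨v, hv, -⟩ := hbb.exists_subset_of_mem_open (mem_univ y) isOpen_univ
    exact ⟨v, hv⟩
  obtain ⟨e, he⟩ := hbc.exists_eq_range hbne
  have heo : ∀ n, IsOpen (e n) := fun n => hbb.isOpen (he ▸ mem_range_self n)
  have hen : ∀ n, (e n).Nonempty := fun n =>
    TopologicalSpace.nonempty_of_mem_countableBasis (he ▸ mem_range_self n)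
  let St : ℕ → Type := fun n => {D : (Fin n → Bool) → Set Y // ∀ s, IsOpen (D s) ∧ (D s).Nonempty}
  have hst : ∀ n (D : St n), ∃ D' : St (n + 1), (∀ s, closure (D'.1 s) ⊆ D.1 (Fin.init s)) ∧
      ∀ s t, s ≠ t → Good (e (Nat.unpair n).1) (closure (D'.1 s)) (closure (D'.1 t)) := by
    intro n D
    obtain ⟨D', h1, h2, h3, h4⟩ := step hI (heo (Nat.unpair n).1) (hen _)
      (fun s : Fin (n + 1) → Bool => D.1 (Fin.init s)) (fun s => (D.2 _).1) (fun s => (D.2 _).2)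
    exact ⟨⟨D', fun s => ⟨h2 s, h3 s⟩⟩, h1, h4⟩
  choose nx hnx1 hnx2 using hst
  let D : (n : ℕ) → St n := fun n =>
    Nat.rec ⟨fun _ => univ, fun _ => ⟨isOpen_univ, univ_nonempty⟩⟩ (fun n D => nx n D) n
  have hDs : ∀ n, D (n + 1) = nx n (D n) := fun n => rfl
  have hex : ∀ s : ℕ → Bool, (⋂ n, closure ((D n).1 fun i => s i)).Nonempty := by
    intro s
    refine IsCompact.nonempty_iInter_of_sequence_nonempty_isCompact_isClosed _ ?_ ?_ ?_ ?_
    · intro n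
      rw [hDs]
      exact (hnx1 n (D n) (fun i => s i)).trans subset_closure
    · exact fun n => ((D n).2 _).2.closure
    · exact isClosed_closure.isCompact
    · exact fun n => isClosed_closure
  choose f hf using hex
  refine ⟨f, fun s t hst L hL hLp hs ht => ?_⟩
  by_contra hne
  obtain ⟨y, hy⟩ := (ne_univ_iff_exists_notMem L).1 hne
  obtain ⟨v, hv, -, hvL⟩ := hbb.exists_subset_of_mem_open (show y ∈ Lᶜ from hy) hL.isOpen_compl
  rw [he] at hv
  obtain ⟨i, rfl⟩ := hv
  obtain ⟨k, hk⟩ := Function.ne_iff.1 hst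
  have h1 := mem_iInter.1 (hf s) (Nat.pair i k + 1)
  have h2 := mem_iInter.1 (hf t) (Nat.pair i k + 1)
  rw [hDs] at h1 h2
  have hne' : (fun i' : Fin (Nat.pair i k + 1) => s i') ≠
      (fun i' : Fin (Nat.pair i k + 1) => t i') := by
    intro h'
    exact hk (congrFun h' ⟨k, Nat.lt_succ_of_le (Nat.right_le_pair i k)⟩)
  refine hnx2 _ (D (Nat.pair i k)) _ _ hne' L hL hLp ?_ ⟨_, hs, h1⟩ ⟨_, ht, h2⟩
  rw [Nat.unpair_pair, ← disjoint_iff_inter_eq_empty, disjoint_comm]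
  exact disjoint_left.2 fun z hz => hvL hz

end

theorem exists_family {X : Type} [MetricSpace X] [CompactSpace X] [ConnectedSpace X]
    (h : HU X) (hr : ∀ x : X, R x x) {a b : X} (hab : ¬ R a b) :
    ∃ f : (ℕ → Bool) → X, ∀ s t, s ≠ t → ¬ R (f s) (f t) := by
  by_cases hD : Dec X
  · exact case2 h hD hr hab
  unfold Dec at hD
  push Not at hD
  obtain ⟨I, hIc, hIp, hIi, hI⟩ := hD
  have : CompactSpace I := isCompact_iff_compactSpace.1 hIc.isCompact
  have : PreconnectedSpace I := Subtype.preconnectedSpace hIp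
  have : Nonempty I := (hIi.mono interior_subset).to_subtype
  have hemb := hIc.isClosedEmbedding_subtypeVal
  have hind : Indec I := by
    intro H K hH hHp hK hKp hHK
    by_contra hcon
    push Not at hcon
    have hfull : ∀ Z : Set I, Subtype.val '' Z = I → Z = univ := by
      intro Z hZ
      rw [eq_univ_iff_forall]
      intro z
      obtain ⟨w, hw, hwz⟩ : z.1 ∈ Subtype.val '' Z := by
        rw [hZ]; exact z.2
      rwa [← Subtype.ext hwz]
    refine hcon.2 (hfull K (hI _ _ (hemb.isClosedMap _ hH)
      (hHp.image _ continuous_subtype_val.continuousOn) (hemb.isClosedMap _ hK)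
      (hKp.image _ continuous_subtype_val.continuousOn) ?_ fun h' => hcon.1 (hfull H h')))
    rw [← image_union, hHK, image_univ, Subtype.range_coe]
  obtain ⟨f, hf⟩ := case1 hind
  refine ⟨fun s => (f s).1, fun s t hst hR => ?_⟩
  have hp : IsPreconnected (Subtype.val ⁻¹' (seg (f s).1 (f t).1) : Set I) := by
    rw [← Topology.IsInducing.subtypeVal.isPreconnected_image, Subtype.image_preimage_coe]
    exact h _ _ hIc hIp (seg_closed _ _) (seg_pre h _ _)
  have hu := hf s t hst _ ((seg_closed _ _).preimage continuous_subtype_val) hp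
    (left_mem _ _) (right_mem _ _)
  have hsub : I ⊆ seg (f s).1 (f t).1 := by
    intro z hz
    have : (⟨z, hz⟩ : I) ∈ (Subtype.val ⁻¹' (seg (f s).1 (f t).1) : Set I) := hu ▸ mem_univ _
    exact this
  obtain ⟨z, hz⟩ := hIi
  have := interior_mono hsub hz
  rw [R] at hR
  rw [hR] at this
  exact this

theorem mem_meager {X : Type} [TopologicalSpace X] [T2Space X] [CompactSpace X] [ConnectedSpace X]
    (h : HU X) (x y : X) : y ∈ MeagerComposant X x ↔ R x y := by
  constructor
  · rintro ⟨L, ⟨h1, h2, h3, h4⟩, h5⟩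
    refine R_of_sub (seg_sub h1.isClosed h2.isPreconnected h4 h5) ?_
    rwa [← h1.isClosed.isNowhereDense_iff]
  · intro hR
    exact ⟨seg x y, ⟨(seg_closed _ _).isCompact, ⟨⟨_, left_mem _ _⟩, seg_pre h _ _⟩,
      (seg_closed _ _).isNowhereDense_iff.2 hR, left_mem _ _⟩, right_mem _ _⟩

theorem mk_le_continuum (X : Type) [MetricSpace X] [CompactSpace X] :
    Cardinal.mk X ≤ Cardinal.continuum := by
  have hbc := TopologicalSpace.countable_countableBasis X
  have hbb := TopologicalSpace.isBasis_countableBasis X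
  have : Countable (TopologicalSpace.countableBasis X) := hbc.to_subtype
  have hinj : Function.Injective
      (fun x : X => {v : TopologicalSpace.countableBasis X | x ∈ v.1}) := by
    intro x y hxy
    by_contra hne
    obtain ⟨v, hv, hxv, hvs⟩ := hbb.exists_subset_of_mem_open (show x ∈ ({y}ᶜ : Set X) from hne)
      isOpen_compl_singleton
    have this : y ∈ v := (Set.ext_iff.1 hxy ⟨v, hv⟩).1 hxv
    exact hvs this rfl
  refine (Cardinal.mk_le_of_injective hinj).trans ?_
  rw [Cardinal.mk_set, ← Cardinal.two_power_aleph0]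
  exact Cardinal.power_le_power_left two_ne_zero (Cardinal.mk_le_aleph0)

end MC

/-- Every tree-like continuum has exactly `1` or exactly `2 ^ ℵ₀` meager composants. -/
theorem card_meagerComposants_treeLike (X : Type) [MetricSpace X] [CompactSpace X] [ConnectedSpace X] [Nonempty X]
    (hX : TreeLike X) :
    Cardinal.mk {S : Set X | ∃ x : X, S = MeagerComposant X x} = 1 ∨
      Cardinal.mk {S : Set X | ∃ x : X, S = MeagerComposant X x} = Cardinal.continuum := by
  have h : MC.HU X := fun A B hA hAp hB hBp => MC.hu_of_treeLike hX hA hAp hB hBp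
  by_cases hall : ∀ x y, MeagerComposant X x = MeagerComposant X y
  · left
    obtain ⟨x0⟩ := ‹Nonempty X›
    have : {S : Set X | ∃ x : X, S = MeagerComposant X x} = {MeagerComposant X x0} := by
      ext S
      constructor
      · rintro ⟨x, rfl⟩; exact hall x x0
      · rintro rfl; exact ⟨x0, rfl⟩
    rw [this, Cardinal.mk_singleton]
  · right
    push Not at hall
    obtain ⟨a, b, hab⟩ := hall
    have hnt : Nontrivial X := ⟨a, b, fun e => hab (by rw [e])⟩
    have hr : ∀ x : X, MC.R x x := fun x => by
      rw [MC.R, MC.seg_self]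
      exact interior_singleton x
    have hnR : ¬ MC.R a b := by
      intro hR
      apply hab
      ext z
      rw [MC.mem_meager h, MC.mem_meager h]
      exact ⟨fun h' => hR.symm.trans h h', fun h' => hR.trans h h'⟩
    obtain ⟨f, hf⟩ := MC.exists_family h hr hnR
    apply le_antisymm
    · have hs : Function.Surjective (fun x : X =>
          (⟨MeagerComposant X x, x, rfl⟩ : {S : Set X | ∃ x : X, S = MeagerComposant X x})) := by
        rintro ⟨S, x, rfl⟩
        exact ⟨x, rfl⟩
      exact (Cardinal.mk_le_of_surjective hs).trans (MC.mk_le_continuum X)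
    · have hi : Function.Injective (fun s : ℕ → Bool =>
          (⟨MeagerComposant X (f s), f s, rfl⟩ :
            {S : Set X | ∃ x : X, S = MeagerComposant X x})) := by
        intro s t hst
        by_contra hne
        have h1 : MeagerComposant X (f s) = MeagerComposant X (f t) := congrArg Subtype.val hst
        have h2 : f t ∈ MeagerComposant X (f s) := by
          rw [h1, MC.mem_meager h]; exact hr _
        exact hf s t hne ((MC.mem_meager h _ _).1 h2)
      have := Cardinal.mk_le_of_injective hi
      have e : Cardinal.mk (ℕ → Bool) = Cardinal.continuum := by simp
      exact e.symm.le.trans this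
end
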